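/- arXiv:1911.04097 — 2 statements merged into one kernel-verified Lean document; each statement's English description precedes it below -/
import Mathlib

section
/- Every stable solution of the Ginzburg–Landau equation ε²Δu = (|u|² − 1)u on the round sphere S^n for n ≥ 2 is a constant with absolute value 1, regardless of the value of ε > 0. -/
open MeasureTheory
open scoped RealInnerProductSpace

noncomputable section

/-! Basic spherical calculus on the unit sphere `S = {‖x‖ = 1} ⊂ ℝ^ι`, done via ambient
(0-homogeneous) extensions.  The tangential gradient, divergence and the induced
Laplace–Beltrami operator are the standard ones of the round metric. -/

variable {ι : Type*} [Fintype ι] [DecidableEq ι]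

/-- The unit sphere, as a subset of Euclidean space. -/
def Sph (ι : Type*) [Fintype ι] : Set (EuclideanSpace ℝ ι) := {x | ‖x‖ = 1}

/-- Tangential (spherical) gradient of an ambient real-valued function: the orthogonal
projection of the ambient gradient onto the tangent space of the sphere.  At points of the
sphere it depends only on the restriction of `f` to the sphere. -/
def gradS (f : EuclideanSpace ℝ ι → ℝ) (x : EuclideanSpace ℝ ι) : EuclideanSpace ℝ ι :=
  _root_.gradient f x - ⟪_root_.gradient f x, x⟫ • x

/-- Spherical divergence (at unit vectors `x`) of an ambient vector field which is tangent
along the sphere: the trace of the ambient derivative over the tangent space `x^⊥`. -/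
def divS (Y : EuclideanSpace ℝ ι → EuclideanSpace ℝ ι) (x : EuclideanSpace ℝ ι) : ℝ :=
  (∑ i, ⟪fderiv ℝ Y x (EuclideanSpace.single i (1 : ℝ)), EuclideanSpace.single i (1 : ℝ)⟫)
    - ⟪fderiv ℝ Y x x, x⟫

def uRe (u : EuclideanSpace ℝ ι → ℂ) : EuclideanSpace ℝ ι → ℝ := fun x => (u x).re
def uIm (u : EuclideanSpace ℝ ι → ℂ) : EuclideanSpace ℝ ι → ℝ := fun x => (u x).im

/-- Laplace–Beltrami operator of the round sphere, computed on a 0-homogeneous ambient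
extension as the spherical divergence of the spherical gradient. -/
def lapS (f : EuclideanSpace ℝ ι → ℝ) (x : EuclideanSpace ℝ ι) : ℝ := divS (gradS f) x

/-- Componentwise sphere Laplacian of a ℂ-valued function. -/
def lapSC (u : EuclideanSpace ℝ ι → ℂ) (x : EuclideanSpace ℝ ι) : ℂ :=
  (lapS (uRe u) x : ℂ) + (lapS (uIm u) x : ℂ) * Complex.I

/-- `u` is the canonical (0-homogeneous) ambient extension of a smooth function on the
sphere: smooth away from the origin and invariant under positive dilations. -/
def SphFun (u : EuclideanSpace ℝ ι → ℂ) : Prop :=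
  ContDiffOn ℝ (⊤ : ℕ∞) u {x | x ≠ 0} ∧ ∀ c : ℝ, 0 < c → ∀ x : EuclideanSpace ℝ ι, x ≠ 0 → u (c • x) = u x

/-- `|∇u|²`, the squared norm of the spherical gradient of a ℂ-valued function. -/
def gradSq (u : EuclideanSpace ℝ ι → ℂ) (x : EuclideanSpace ℝ ι) : ℝ :=
  ‖gradS (uRe u) x‖ ^ 2 + ‖gradS (uIm u) x‖ ^ 2

/-- Ginzburg–Landau energy density `e_ε(u)`. -/
def eGL (ε : ℝ) (u : EuclideanSpace ℝ ι → ℂ) (x : EuclideanSpace ℝ ι) : ℝ :=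
  gradSq u x / 2 + (1 - ‖u x‖ ^ 2) ^ 2 / (4 * ε ^ 2)

/-- Ginzburg–Landau energy `E_ε` on the sphere of dimension `d`, with respect to the
`d`-dimensional Hausdorff measure (the Riemannian volume of the round metric). -/
def EGL (d : ℝ) (ε : ℝ) (u : EuclideanSpace ℝ ι → ℂ) : ℝ :=
  ∫ x in Sph ι, eGL ε u x ∂(Measure.hausdorffMeasure d)

/-- Real inner product of two complex numbers (`ℂ ≅ ℝ²`). -/
def cdot (a b : ℂ) : ℝ := a.re * b.re + a.im * b.im

/-- `u` solves the Ginzburg–Landau equation `ε²Δu = (|u|²-1)u` on the sphere. -/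
def IsGLSolution (ε : ℝ) (u : EuclideanSpace ℝ ι → ℂ) : Prop :=
  SphFun u ∧ ∀ x ∈ Sph ι, (ε ^ 2 : ℂ) * lapSC u x = ((‖u x‖ ^ 2 - 1 : ℝ) : ℂ) * u x

/-- Second (outer) variation `δ²E_ε(u)(v,v)` on the sphere of dimension `d`. -/
def d2E (d : ℝ) (ε : ℝ) (u v : EuclideanSpace ℝ ι → ℂ) : ℝ :=
  ∫ x in Sph ι,
    (gradSq v x + (‖u x‖ ^ 2 - 1) / ε ^ 2 * ‖v x‖ ^ 2 + 2 / ε ^ 2 * cdot (u x) (v x) ^ 2)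
    ∂(Measure.hausdorffMeasure d)

/-- Stability: the second outer variation is nonnegative (smooth variations, which are
dense in `W^{1,2}`). -/
def IsStable (d : ℝ) (ε : ℝ) (u : EuclideanSpace ℝ ι → ℂ) : Prop :=
  ∀ v : EuclideanSpace ℝ ι → ℂ, ContDiff ℝ (⊤ : ℕ∞) v → 0 ≤ d2E d ε u v

/-- `φ` is the flow of the smooth vector field `X`, which is tangent to the unit sphere
(hence the flow preserves the sphere). -/
def IsSphereFlow (X : EuclideanSpace ℝ ι → EuclideanSpace ℝ ι)
    (φ : ℝ → EuclideanSpace ℝ ι → EuclideanSpace ℝ ι) : Prop :=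
  ContDiff ℝ (⊤ : ℕ∞) X ∧ (∀ x ∈ Sph ι, ⟪X x, x⟫ = 0) ∧ φ 0 = id ∧
    (∀ t x, HasDerivAt (fun s => φ s x) (X (φ t x)) t) ∧
    (ContDiff ℝ (⊤ : ℕ∞) fun p : ℝ × EuclideanSpace ℝ ι => φ p.1 p.2) ∧
    (∀ t, ∀ x ∈ Sph ι, φ t x ∈ Sph ι)

/-! ### The Hausdorff measure of the sphere -/

theorem isCompact_Sph (κ : Type*) [Fintype κ] : IsCompact (Sph κ) := by
  have : Sph κ = Metric.sphere (0 : EuclideanSpace ℝ κ) 1 := by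
    ext x; simp [Sph]
  rw [this]
  exact isCompact_sphere 0 1

theorem measurableSet_Sph (κ : Type*) [Fintype κ] : MeasurableSet (Sph κ) :=
  (isCompact_Sph κ).isClosed.measurableSet

theorem ne_zero_of_mem_Sph {κ : Type*} [Fintype κ] {x : EuclideanSpace ℝ κ} (hx : x ∈ Sph κ) :
    x ≠ 0 := by
  rintro rfl
  simp [Sph] at hx

/-- The point of the cube with `i`-th coordinate `s` and remaining coordinates `y`, pushed radially
to the unit sphere. -/
def cubeFace {n : ℕ} (i : Fin (n + 1)) (s : ℝ) (y : Fin n → ℝ) : EuclideanSpace ℝ (Fin (n + 1)) :=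
  ‖WithLp.toLp 2 (i.insertNth (α := fun _ => ℝ) s y)‖⁻¹ •
    WithLp.toLp 2 (i.insertNth (α := fun _ => ℝ) s y)

theorem contDiff_cubeFace {n : ℕ} (i : Fin (n + 1)) {s : ℝ} (hs : s ≠ 0) :
    ContDiff ℝ 1 (cubeFace (n := n) i s) := by
  have h : ContDiff ℝ 1 fun y : Fin n → ℝ =>
      (WithLp.toLp 2 (i.insertNth (α := fun _ => ℝ) s y) : EuclideanSpace ℝ (Fin (n + 1))) := by
    rw [contDiff_euclidean]
    intro j
    refine Fin.succAboveCases i ?_ (fun k => ?_) j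
    · simpa using contDiff_const
    · simpa using contDiff_apply ℝ ℝ k
  have h0 : ∀ y : Fin n → ℝ,
      (WithLp.toLp 2 (i.insertNth (α := fun _ => ℝ) s y) : EuclideanSpace ℝ (Fin (n + 1))) ≠ 0 := by
    intro y hy
    have := congrArg (fun z : EuclideanSpace ℝ (Fin (n + 1)) => z i) hy
    simp [hs] at this
  exact ((h.norm ℝ h0).inv fun y => norm_ne_zero_iff.2 (h0 y)).smul h

theorem Sph_subset_cubeFace (n : ℕ) : Sph (Fin (n + 1)) ⊆
    ⋃ i : Fin (n + 1), (cubeFace i 1 '' Set.Icc (-1) 1 ∪ cubeFace i (-1) '' Set.Icc (-1) 1) := by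
  intro x hx
  have hx0 := ne_zero_of_mem_Sph hx
  obtain ⟨i, -, hi⟩ := Finset.exists_max_image Finset.univ (fun i => |x i|) ⟨0, by simp⟩
  have hi0 : 0 < |x i| := by
    rw [abs_pos]
    intro h
    apply hx0
    ext j
    have := hi j (Finset.mem_univ j)
    simpa [h] using this
  have key : ∀ s : ℝ, s * |x i| = x i → x = cubeFace i s (fun k => |x i|⁻¹ * x (i.succAbove k)) := by
    intro s hs
    have h1 : (WithLp.toLp 2 (i.insertNth (α := fun _ => ℝ) s
        (fun k => |x i|⁻¹ * x (i.succAbove k))) : EuclideanSpace ℝ (Fin (n + 1))) = |x i|⁻¹ • x := by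
      ext j
      refine Fin.succAboveCases i ?_ (fun k => ?_) j
      · simp only [Fin.insertNth_apply_same, PiLp.smul_apply, smul_eq_mul]
        rw [eq_inv_mul_iff_mul_eq₀ hi0.ne', mul_comm, hs]
      · simp
    rw [cubeFace, h1, norm_smul, smul_smul]
    have : ‖x‖ = 1 := hx
    rw [this, mul_one, norm_inv, Real.norm_eq_abs, abs_abs, inv_inv, mul_inv_cancel₀ hi0.ne', one_smul]
  have hmem : (fun k => |x i|⁻¹ * x (i.succAbove k)) ∈ Set.Icc (-1 : Fin n → ℝ) 1 := by
    have : ∀ k, |(|x i|⁻¹ * x (i.succAbove k))| ≤ 1 := by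
      intro k
      rw [abs_mul, abs_inv, abs_abs, inv_mul_le_one₀ hi0]
      exact hi _ (Finset.mem_univ _)
    exact ⟨fun k => (abs_le.1 (this k)).1, fun k => (abs_le.1 (this k)).2⟩
  refine Set.mem_iUnion.2 ⟨i, ?_⟩
  rcases abs_choice (x i) with h | h
  · exact Or.inl ⟨_, hmem, (key 1 (by rw [h, one_mul])).symm⟩
  · exact Or.inr ⟨_, hmem, (key (-1) (by rw [h]; ring)).symm⟩

theorem hausdorffMeasure_Sph_lt_top (n : ℕ) :
    Measure.hausdorffMeasure (n : ℝ) (Sph (Fin (n + 1))) < ⊤ := by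
  have key : ∀ (i : Fin (n + 1)) (s : ℝ), s ≠ 0 →
      Measure.hausdorffMeasure (n : ℝ) (cubeFace i s '' Set.Icc (-1 : Fin n → ℝ) 1) < ⊤ := by
    intro i s hs
    obtain ⟨K, hK⟩ := ((contDiff_cubeFace i hs).locallyLipschitz.locallyLipschitzOn
      (s := Set.Icc (-1 : Fin n → ℝ) 1)).exists_lipschitzOnWith_of_compact isCompact_Icc
    refine (hK.hausdorffMeasure_image_le n.cast_nonneg).trans_lt ?_
    have : Measure.hausdorffMeasure (n : ℝ) = (volume : Measure (Fin n → ℝ)) := by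
      simpa using hausdorffMeasure_pi_real (ι := Fin n)
    rw [this]
    exact ENNReal.mul_lt_top (ENNReal.rpow_lt_top_of_nonneg n.cast_nonneg ENNReal.coe_ne_top)
      isCompact_Icc.measure_lt_top
  refine (measure_mono (Sph_subset_cubeFace n)).trans_lt ?_
  refine (measure_iUnion_le _).trans_lt ?_
  rw [tsum_fintype]
  refine ENNReal.sum_lt_top.2 fun i _ => ?_
  exact measure_union_lt_top (key i 1 one_ne_zero) (key i (-1) (by norm_num))

theorem hausdorffMeasure_Sph_ne_zero (n : ℕ) :
    Measure.hausdorffMeasure (n : ℝ) (Sph (Fin (n + 1))) ≠ 0 := by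
  intro h0
  let P : EuclideanSpace ℝ (Fin (n + 1)) → EuclideanSpace ℝ (Fin n) :=
    fun x => WithLp.toLp 2 fun k => x k.succ
  have hP : LipschitzWith 1 P := by
    refine LipschitzWith.of_dist_le_mul fun x y => ?_
    rw [NNReal.coe_one, one_mul, EuclideanSpace.dist_eq, EuclideanSpace.dist_eq]
    apply Real.sqrt_le_sqrt
    rw [Fin.sum_univ_succ (n := n)]
    simp [P]
  have hsub : Metric.ball (0 : EuclideanSpace ℝ (Fin n)) 1 ⊆ P '' Sph (Fin (n + 1)) := by
    intro y hy
    have hy1 : ‖y‖ < 1 := by simpa using hy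
    have hy2 : ∑ k, y k ^ 2 ≤ 1 := by
      rw [← EuclideanSpace.real_norm_sq_eq]; nlinarith [norm_nonneg y]
    refine ⟨WithLp.toLp 2 (Fin.cons (√(1 - ∑ k, y k ^ 2)) fun k => y k), ?_, ?_⟩
    · have : ‖(WithLp.toLp 2 (Fin.cons (√(1 - ∑ k, y k ^ 2)) fun k => y k) :
          EuclideanSpace ℝ (Fin (n + 1)))‖ ^ 2 = 1 := by
        rw [EuclideanSpace.real_norm_sq_eq, Fin.sum_univ_succ]
        simp [Real.sq_sqrt (sub_nonneg.2 hy2)]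
      exact (pow_eq_one_iff_of_nonneg (norm_nonneg _) two_ne_zero).1 this
    · ext k
      simp [P]
  have hH : (Measure.hausdorffMeasure (n : ℝ) :
      Measure (EuclideanSpace ℝ (Fin n))).IsAddHaarMeasure := by
    simpa using MeasureTheory.isAddHaarMeasure_hausdorffMeasure (E := EuclideanSpace ℝ (Fin n))
  have h1 := (measure_mono hsub).trans
    (hP.hausdorffMeasure_image_le n.cast_nonneg (Sph (Fin (n + 1))))
  rw [h0, mul_zero] at h1
  exact (Metric.measure_ball_pos (Measure.hausdorffMeasure (n : ℝ))
    (0 : EuclideanSpace ℝ (Fin n)) one_pos).not_ge h1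

theorem integrableOn_Sph {n : ℕ} {F : EuclideanSpace ℝ (Fin (n + 1)) → ℝ}
    (hF : ContinuousOn F (Sph (Fin (n + 1)))) :
    IntegrableOn F (Sph (Fin (n + 1))) (Measure.hausdorffMeasure (n : ℝ)) := by
  obtain ⟨C, hC⟩ := (isCompact_Sph (Fin (n + 1))).exists_bound_of_continuousOn hF
  refine IntegrableOn.of_bound (hausdorffMeasure_Sph_lt_top n)
    (hF.aestronglyMeasurable (measurableSet_Sph _)) C ?_
  exact (ae_restrict_iff' (measurableSet_Sph _)).2 (Filter.Eventually.of_forall hC)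

theorem preimage_Sph {κ : Type*} [Fintype κ] (e : EuclideanSpace ℝ κ ≃ₗᵢ[ℝ] EuclideanSpace ℝ κ) :
    e ⁻¹' Sph κ = Sph κ := by
  ext x
  simp [Sph]

theorem setIntegral_Sph_comp {κ : Type*} [Fintype κ] (d : ℝ)
    (e : EuclideanSpace ℝ κ ≃ₗᵢ[ℝ] EuclideanSpace ℝ κ) (F : EuclideanSpace ℝ κ → ℝ) :
    ∫ x in Sph κ, F (e x) ∂(Measure.hausdorffMeasure d) =
      ∫ x in Sph κ, F x ∂(Measure.hausdorffMeasure d) := by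
  have h := (e.toIsometryEquiv.measurePreserving_hausdorffMeasure d).setIntegral_preimage_emb
    e.toHomeomorph.measurableEmbedding F (Sph κ)
  have h2 : (e.toIsometryEquiv : EuclideanSpace ℝ κ → EuclideanSpace ℝ κ) ⁻¹' Sph κ = Sph κ :=
    preimage_Sph e
  rw [h2] at h
  exact h

theorem eq_zero_of_setIntegral_Sph_eq_zero {n : ℕ} {F : EuclideanSpace ℝ (Fin (n + 1)) → ℝ}
    (hF : ContinuousOn F (Sph (Fin (n + 1)))) (hF0 : ∀ x ∈ Sph (Fin (n + 1)), 0 ≤ F x)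
    (hI : ∫ x in Sph (Fin (n + 1)), F x ∂(Measure.hausdorffMeasure (n : ℝ)) = 0) :
    ∀ x ∈ Sph (Fin (n + 1)), F x = 0 := by
  intro p hp
  by_contra hne
  have hae := (setIntegral_eq_zero_iff_of_nonneg_ae
    ((ae_restrict_iff' (measurableSet_Sph _)).2 (Filter.Eventually.of_forall hF0))
    (integrableOn_Sph hF)).1 hI
  have hnull : Measure.hausdorffMeasure (n : ℝ) {x | x ∈ Sph (Fin (n + 1)) ∧ F x ≠ 0} = 0 := by
    have := (ae_restrict_iff' (measurableSet_Sph _)).1 hae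
    rw [ae_iff] at this
    convert this using 2
    ext x
    simp
  have hmem : {x | x ∈ Sph (Fin (n + 1)) ∧ F x ≠ 0} ∈ nhdsWithin p (Sph (Fin (n + 1))) :=
    Filter.inter_mem self_mem_nhdsWithin ((hF p hp).eventually_ne hne)
  refine hausdorffMeasure_Sph_ne_zero n ?_
  refine measure_null_of_locally_null _ fun q hq => ?_
  set e := Submodule.reflection (ℝ ∙ (q - p))ᗮ
  have hpq : ‖q‖ = ‖p‖ := by
    rw [show ‖q‖ = 1 from hq, show ‖p‖ = 1 from hp]
  have heq : e q = p := Submodule.reflection_sub hpq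
  refine ⟨e ⁻¹' {x | x ∈ Sph (Fin (n + 1)) ∧ F x ≠ 0}, ?_, ?_⟩
  · have ht : Filter.Tendsto e (nhdsWithin q (Sph (Fin (n + 1))))
        (nhdsWithin p (Sph (Fin (n + 1)))) := by
      refine tendsto_nhdsWithin_iff.2 ⟨?_, ?_⟩
      · rw [← heq]
        exact e.continuous.continuousAt.tendsto.mono_left nhdsWithin_le_nhds
      · filter_upwards [self_mem_nhdsWithin] with x hx
        simpa [Sph] using hx
    exact ht hmem
  · have := e.toIsometryEquiv.hausdorffMeasure_preimage (n : ℝ)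
      {x | x ∈ Sph (Fin (n + 1)) ∧ F x ≠ 0}
    rw [hnull] at this
    exact this

set_option linter.unusedSectionVars false

/-! ### Calculus on the punctured space -/

/-- The `i`-th partial derivative. -/
def pd (i : ι) (f : EuclideanSpace ℝ ι → ℝ) (x : EuclideanSpace ℝ ι) : ℝ :=
  fderiv ℝ f x (EuclideanSpace.single i (1 : ℝ))

/-- Smoothness away from the origin. -/
def PuncturedSmooth (f : EuclideanSpace ℝ ι → ℝ) : Prop :=
  ContDiffOn ℝ (⊤ : ℕ∞) f {x | x ≠ 0}

/-- Positive homogeneity of degree `m` away from the origin. -/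
def IsHom (m : ℤ) (f : EuclideanSpace ℝ ι → ℝ) : Prop :=
  ∀ c : ℝ, 0 < c → ∀ x : EuclideanSpace ℝ ι, x ≠ 0 → f (c • x) = c ^ m * f x

/-- The derivative along the rotation field in the `(i, j)`-plane. -/
def killing (i j : ι) (f : EuclideanSpace ℝ ι → ℝ) (x : EuclideanSpace ℝ ι) : ℝ :=
  x i * pd j f x - x j * pd i f x

/-- On the unit sphere, the inner product of the tangential gradients of `f` and `g`. -/
def carre (f g : EuclideanSpace ℝ ι → ℝ) (x : EuclideanSpace ℝ ι) : ℝ :=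
  ∑ i, pd i f x * pd i g x - (∑ i, x i * pd i f x) * ∑ i, x i * pd i g x

/-- The Euclidean Laplacian. -/
def lapE (f : EuclideanSpace ℝ ι → ℝ) (x : EuclideanSpace ℝ ι) : ℝ := ∑ i, pd i (pd i f) x

/-- The second derivative in the radial direction. -/
def hessRad (f : EuclideanSpace ℝ ι → ℝ) (x : EuclideanSpace ℝ ι) : ℝ :=
  ∑ i, ∑ j, x i * x j * pd j (pd i f) x

theorem fderiv_apply_eq_sum_pd (f : EuclideanSpace ℝ ι → ℝ) (x y : EuclideanSpace ℝ ι) :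
    fderiv ℝ f x y = ∑ i, y i * pd i f x := by
  have hy : y = ∑ i, y i • EuclideanSpace.single i (1 : ℝ) := by
    ext j
    simp [Pi.single_apply]
  conv_lhs => rw [hy]
  simp [pd]

theorem isOpen_punctured : IsOpen {x : EuclideanSpace ℝ ι | x ≠ 0} := isOpen_ne

theorem Filter.EventuallyEq.pd_eq {i : ι} {f g : EuclideanSpace ℝ ι → ℝ} {x : EuclideanSpace ℝ ι}
    (h : f =ᶠ[nhds x] g) : pd i f x = pd i g x := by
  rw [pd, pd, h.fderiv_eq]

theorem eventually_punctured {x : EuclideanSpace ℝ ι} (hx : x ≠ 0) :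
    ∀ᶠ y in nhds x, y ≠ (0 : EuclideanSpace ℝ ι) := isOpen_punctured.mem_nhds hx

namespace PuncturedSmooth

variable {f g : EuclideanSpace ℝ ι → ℝ} {x : EuclideanSpace ℝ ι}

theorem contDiffAt (hf : PuncturedSmooth f) (hx : x ≠ 0) : ContDiffAt ℝ (⊤ : ℕ∞) f x :=
  ContDiffOn.contDiffAt hf (isOpen_punctured.mem_nhds hx)

theorem differentiableAt (hf : PuncturedSmooth f) (hx : x ≠ 0) : DifferentiableAt ℝ f x :=
  (hf.contDiffAt hx).differentiableAt (by simp)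

theorem continuousOn_Sph (hf : PuncturedSmooth f) : ContinuousOn f (Sph ι) :=
  (ContDiffOn.continuousOn hf).mono fun _ hx => ne_zero_of_mem_Sph hx

theorem const (c : ℝ) : PuncturedSmooth fun _ : EuclideanSpace ℝ ι => c := contDiffOn_const

theorem coord (i : ι) : PuncturedSmooth fun x : EuclideanSpace ℝ ι => x i :=
  (contDiff_piLp_apply (p := 2)).contDiffOn

theorem add (hf : PuncturedSmooth f) (hg : PuncturedSmooth g) :
    PuncturedSmooth fun x => f x + g x := ContDiffOn.add hf hg

theorem sub (hf : PuncturedSmooth f) (hg : PuncturedSmooth g) :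
    PuncturedSmooth fun x => f x - g x := ContDiffOn.sub hf hg

theorem mul (hf : PuncturedSmooth f) (hg : PuncturedSmooth g) :
    PuncturedSmooth fun x => f x * g x := ContDiffOn.mul hf hg

theorem pow (hf : PuncturedSmooth f) (k : ℕ) : PuncturedSmooth fun x => f x ^ k :=
  ContDiffOn.pow hf k

theorem sum {α : Type*} {s : Finset α} {F : α → EuclideanSpace ℝ ι → ℝ}
    (hF : ∀ a ∈ s, PuncturedSmooth (F a)) : PuncturedSmooth fun x => ∑ a ∈ s, F a x :=
  ContDiffOn.sum hF

theorem pd (hf : PuncturedSmooth f) (i : ι) : PuncturedSmooth (pd i f) := by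
  have h : ContDiffOn ℝ (⊤ : ℕ∞) (fderiv ℝ f) {x | x ≠ 0} :=
    ContDiffOn.fderiv_of_isOpen hf isOpen_punctured (by simp)
  exact h.clm_apply contDiffOn_const

theorem carre (hf : PuncturedSmooth f) (hg : PuncturedSmooth g) :
    PuncturedSmooth (carre f g) :=
  (sum fun i _ => (hf.pd i).mul (hg.pd i)).sub
    ((sum fun i _ => (coord i).mul (hf.pd i)).mul (sum fun i _ => (coord i).mul (hg.pd i)))

theorem lapE (hf : PuncturedSmooth f) : PuncturedSmooth (lapE f) :=
  sum fun i _ => (hf.pd i).pd i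

theorem killing (hf : PuncturedSmooth f) (i j : ι) : PuncturedSmooth (killing i j f) :=
  ((coord i).mul (hf.pd j)).sub ((coord j).mul (hf.pd i))

end PuncturedSmooth

section Partial

variable {f g : EuclideanSpace ℝ ι → ℝ} {x : EuclideanSpace ℝ ι}

theorem pd_coord (i k : ι) (x : EuclideanSpace ℝ ι) :
    pd i (fun y : EuclideanSpace ℝ ι => y k) x = if k = i then 1 else 0 := by
  have : HasFDerivAt (fun y : EuclideanSpace ℝ ι => y k) (EuclideanSpace.proj (𝕜 := ℝ) k) x :=
    (EuclideanSpace.proj (𝕜 := ℝ) k : EuclideanSpace ℝ ι →L[ℝ] ℝ).hasFDerivAt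
  rw [pd, this.fderiv]
  simp

theorem pd_add (i : ι) (hf : PuncturedSmooth f) (hg : PuncturedSmooth g) (hx : x ≠ 0) :
    pd i (fun y => f y + g y) x = pd i f x + pd i g x := by
  rw [pd, fderiv_fun_add (hf.differentiableAt hx) (hg.differentiableAt hx)]
  rfl

theorem pd_sub (i : ι) (hf : PuncturedSmooth f) (hg : PuncturedSmooth g) (hx : x ≠ 0) :
    pd i (fun y => f y - g y) x = pd i f x - pd i g x := by
  rw [pd, fderiv_fun_sub (hf.differentiableAt hx) (hg.differentiableAt hx)]
  rfl

theorem pd_mul (i : ι) (hf : PuncturedSmooth f) (hg : PuncturedSmooth g) (hx : x ≠ 0) :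
    pd i (fun y => f y * g y) x = f x * pd i g x + g x * pd i f x := by
  rw [pd, fderiv_fun_mul (hf.differentiableAt hx) (hg.differentiableAt hx)]
  rfl

theorem pd_const (i : ι) (c : ℝ) (x : EuclideanSpace ℝ ι) : pd i (fun _ => c) x = 0 := by
  simp [pd]

theorem pd_sum {α : Type*} (s : Finset α) (i : ι) {F : α → EuclideanSpace ℝ ι → ℝ}
    (hF : ∀ a ∈ s, PuncturedSmooth (F a)) (hx : x ≠ 0) :
    pd i (fun y => ∑ a ∈ s, F a y) x = ∑ a ∈ s, pd i (F a) x := by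
  rw [pd, fderiv_fun_sum fun a ha => (hF a ha).differentiableAt hx]
  simp [pd]

theorem pd_comm (i j : ι) (hf : PuncturedSmooth f) (hx : x ≠ 0) :
    pd i (pd j f) x = pd j (pd i f) x := by
  have hs : IsSymmSndFDerivAt ℝ f x :=
    (hf.contDiffAt hx).isSymmSndFDerivAt <| by
      rw [minSmoothness_of_isRCLikeNormedField]
      exact WithTop.coe_le_coe.2 (le_top : (2 : ℕ∞) ≤ ⊤)
  have hd : DifferentiableAt ℝ (fderiv ℝ f) x :=
    ((hf.contDiffAt hx).fderiv_right (m := 1) (by norm_cast)).differentiableAt (by simp)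
  have key : ∀ i j, pd i (pd j f) x =
      fderiv ℝ (fderiv ℝ f) x (EuclideanSpace.single i 1) (EuclideanSpace.single j 1) := by
    intro i j
    have : pd j f = fun y => fderiv ℝ f y (EuclideanSpace.single j 1) := rfl
    rw [this, pd, fderiv_clm_apply hd (differentiableAt_const _)]
    simp
  rw [key, key, hs.eq]

theorem pd_lapE (i : ι) (hf : PuncturedSmooth f) (hx : x ≠ 0) :
    pd i (lapE f) x = lapE (pd i f) x := by
  have : lapE f = fun y => ∑ k, pd k (pd k f) y := rfl
  rw [this, pd_sum _ _ (fun k _ => (hf.pd k).pd k) hx, lapE]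
  refine Finset.sum_congr rfl fun k _ => ?_
  rw [pd_comm i k (hf.pd k) hx]
  apply Filter.EventuallyEq.pd_eq
  filter_upwards [eventually_punctured hx] with y hy using pd_comm i k hf hy

end Partial

namespace IsHom

variable {f : EuclideanSpace ℝ ι → ℝ} {m : ℤ}

theorem pd (hf : IsHom m f) (i : ι) : IsHom (m - 1) (pd i f) := by
  intro c hc x hx
  have h1 : fderiv ℝ (fun y => f (c • y)) x = c ^ m • fderiv ℝ f x := by
    refine Eq.trans ?_ (congrFun (fderiv_const_smul_field (𝕜 := ℝ) (f := f) (c ^ m)) x)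
    apply Filter.EventuallyEq.fderiv_eq
    filter_upwards [eventually_punctured hx] with y hy
    simpa using hf c hc y hy
  rw [fderiv_comp_smul] at h1
  have h2 := congrArg (fun L => L (EuclideanSpace.single i (1 : ℝ))) h1
  simp only [_root_.smul_apply, smul_eq_mul] at h2
  rw [_root_.pd, _root_.pd, zpow_sub_one₀ hc.ne', mul_right_comm, ← h2]
  field_simp

theorem lapE (hf : IsHom m f) : IsHom (m - 2) (lapE f) := by
  intro c hc x hx
  simp only [_root_.lapE, Finset.mul_sum]
  refine Finset.sum_congr rfl fun i _ => ?_
  rw [show m - 2 = m - 1 - 1 by ring]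
  exact (hf.pd i).pd i c hc x hx

theorem sum_mul_pd (hf : IsHom m f) (hs : PuncturedSmooth f) {x : EuclideanSpace ℝ ι}
    (hx : x ≠ 0) : ∑ i, x i * _root_.pd i f x = m * f x := by
  rw [← fderiv_apply_eq_sum_pd]
  have h1 : HasDerivAt (fun c : ℝ => f (c • x)) (fderiv ℝ f x x) 1 := by
    have hd : HasFDerivAt f (fderiv ℝ f x) ((1 : ℝ) • x) := by
      rw [one_smul]; exact (hs.differentiableAt hx).hasFDerivAt
    have := hd.comp_hasDerivAt (1 : ℝ) ((hasDerivAt_id (1 : ℝ)).smul_const x)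
    rwa [one_smul] at this
  have h2 : HasDerivAt (fun c : ℝ => c ^ m * f x) (m * f x) 1 := by
    simpa using (hasDerivAt_zpow m (1 : ℝ) (Or.inl one_ne_zero)).mul_const (f x)
  refine h1.unique (h2.congr_of_eventuallyEq ?_)
  filter_upwards [lt_mem_nhds (zero_lt_one' ℝ)] with c hc using hf c hc x hx

theorem hessRad (hf : IsHom m f) (hs : PuncturedSmooth f) {x : EuclideanSpace ℝ ι}
    (hx : x ≠ 0) : hessRad f x = (m - 1) * m * f x := by
  have h : ∀ i, ∑ j, x i * x j * _root_.pd j (_root_.pd i f) x =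
      (m - 1) * (x i * _root_.pd i f x) := by
    intro i
    have := (hf.pd i).sum_mul_pd (hs.pd i) hx
    simp only [mul_assoc, ← Finset.mul_sum]
    rw [this]; push_cast; ring
  simp only [_root_.hessRad, h, ← Finset.mul_sum]
  rw [hf.sum_mul_pd hs hx]; ring

end IsHom

/-! ### Integration by parts on the sphere -/

/-- The field generating rotations in the `(i, j)`-plane. -/
def rotField (i j : ι) (x : EuclideanSpace ℝ ι) : EuclideanSpace ℝ ι :=
  x i • EuclideanSpace.single j (1 : ℝ) - x j • EuclideanSpace.single i (1 : ℝ)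

theorem fderiv_rotField (i j : ι) (f : EuclideanSpace ℝ ι → ℝ) (x : EuclideanSpace ℝ ι) :
    fderiv ℝ f x (rotField i j x) = killing i j f x := by
  simp [rotField, killing, pd]

/-- Rotation by the angle `t` in the `(i, j)`-plane. -/
def rotLin (i j : ι) (t : ℝ) : EuclideanSpace ℝ ι →ₗ[ℝ] EuclideanSpace ℝ ι where
  toFun x := x + (Real.cos t - 1) •
      (x i • EuclideanSpace.single i (1 : ℝ) + x j • EuclideanSpace.single j (1 : ℝ)) +
    Real.sin t • rotField i j x
  map_add' x y := by
    simp only [rotField, PiLp.add_apply, add_smul]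
    module
  map_smul' c x := by
    simp only [rotField, PiLp.smul_apply, smul_eq_mul, mul_smul, RingHom.id_apply]
    module

theorem rotLin_apply (i j : ι) (t : ℝ) (x : EuclideanSpace ℝ ι) :
    rotLin i j t x = x + (Real.cos t - 1) •
      (x i • EuclideanSpace.single i (1 : ℝ) + x j • EuclideanSpace.single j (1 : ℝ)) +
    Real.sin t • rotField i j x := rfl

theorem norm_rotLin {i j : ι} (hij : i ≠ j) (t : ℝ) (x : EuclideanSpace ℝ ι) :
    ‖rotLin i j t x‖ = ‖x‖ := by
  have h : ‖rotLin i j t x‖ ^ 2 = ‖x‖ ^ 2 := by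
    rw [← real_inner_self_eq_norm_sq, ← real_inner_self_eq_norm_sq]
    simp only [rotLin_apply, rotField, inner_add_left, inner_add_right, inner_sub_left,
      inner_sub_right, real_inner_smul_left, real_inner_smul_right, EuclideanSpace.inner_single_left,
      EuclideanSpace.inner_single_right, map_one, one_mul, conj_trivial]
    simp only [PiLp.add_apply, PiLp.sub_apply, PiLp.smul_apply, smul_eq_mul, PiLp.single_apply,
      hij, hij.symm, if_true, if_false]
    linear_combination ((x i) ^ 2 + (x j) ^ 2) * Real.sin_sq_add_cos_sq t
  exact (sq_eq_sq₀ (norm_nonneg _) (norm_nonneg _)).1 h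

/-- Rotation by the angle `t` in the `(i, j)`-plane, as a linear isometry. -/
def rot {i j : ι} (hij : i ≠ j) (t : ℝ) : EuclideanSpace ℝ ι ≃ₗᵢ[ℝ] EuclideanSpace ℝ ι :=
  LinearIsometry.toLinearIsometryEquiv ⟨rotLin i j t, norm_rotLin hij t⟩ rfl

theorem hasDerivAt_rotLin {i j : ι} (hij : i ≠ j) (x : EuclideanSpace ℝ ι) (t : ℝ) :
    HasDerivAt (fun s => rotLin i j s x) (rotField i j (rotLin i j t x)) t := by
  have h := (((hasDerivAt_const t x).add (((Real.hasDerivAt_cos t).sub_const 1).smul_const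
      (x i • EuclideanSpace.single i (1 : ℝ) + x j • EuclideanSpace.single j (1 : ℝ)))).add
    ((Real.hasDerivAt_sin t).smul_const (rotField i j x)))
  refine h.congr_deriv ?_
  simp only [rotLin_apply, rotField, PiLp.add_apply, PiLp.sub_apply, PiLp.smul_apply, smul_eq_mul,
    PiLp.single_apply, hij, hij.symm, if_true, if_false]
  module

theorem integral_killing {n : ℕ} (i j : Fin (n + 1)) {f : EuclideanSpace ℝ (Fin (n + 1)) → ℝ}
    (hf : PuncturedSmooth f) :
    ∫ x in Sph (Fin (n + 1)), killing i j f x ∂(Measure.hausdorffMeasure (n : ℝ)) = 0 := by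
  rcases eq_or_ne i j with rfl | hij
  · simp [killing]
  have hk : ContinuousOn (killing i j f) (Sph (Fin (n + 1))) := (hf.killing i j).continuousOn_Sph
  obtain ⟨C, hC⟩ := (isCompact_Sph (Fin (n + 1))).exists_bound_of_continuousOn hk
  have hmem : ∀ t, ∀ x ∈ Sph (Fin (n + 1)), rotLin i j t x ∈ Sph (Fin (n + 1)) := fun t x hx =>
    (norm_rotLin hij t x).trans hx
  have hcomp : ∀ (t : ℝ) {g : EuclideanSpace ℝ (Fin (n + 1)) → ℝ},
      ContinuousOn g (Sph (Fin (n + 1))) →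
      ContinuousOn (fun x => g (rotLin i j t x)) (Sph (Fin (n + 1))) := fun t g hg =>
    hg.comp (rot hij t).continuous.continuousOn (hmem t)
  have hderiv := (hasDerivAt_integral_of_dominated_loc_of_deriv_le
    (μ := (Measure.hausdorffMeasure (n : ℝ)).restrict (Sph (Fin (n + 1))))
    (F := fun t x => f (rotLin i j t x)) (F' := fun t x => killing i j f (rotLin i j t x))
    (x₀ := (0 : ℝ)) (s := Set.univ) (bound := fun _ => C) Filter.univ_mem
    (Filter.Eventually.of_forall fun t =>
      (integrableOn_Sph (hcomp t hf.continuousOn_Sph)).aestronglyMeasurable)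
    (integrableOn_Sph (hcomp 0 hf.continuousOn_Sph))
    (integrableOn_Sph (hcomp 0 hk)).aestronglyMeasurable
    ((ae_restrict_iff' (measurableSet_Sph _)).2 <| Filter.Eventually.of_forall fun x hx t _ =>
      hC _ (hmem t x hx))
    (integrableOn_Sph continuousOn_const)
    ((ae_restrict_iff' (measurableSet_Sph _)).2 <| Filter.Eventually.of_forall fun x hx t _ => by
      have hd := (hf.differentiableAt (ne_zero_of_mem_Sph (hmem t x hx))).hasFDerivAt
      have := hd.comp_hasDerivAt t (hasDerivAt_rotLin hij x t)
      rwa [fderiv_rotField] at this)).2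
  have hconst : ∀ t, ∫ x in Sph (Fin (n + 1)), f (rotLin i j t x)
      ∂(Measure.hausdorffMeasure (n : ℝ)) =
      ∫ x in Sph (Fin (n + 1)), f x ∂(Measure.hausdorffMeasure (n : ℝ)) :=
    fun t => setIntegral_Sph_comp _ (rot hij t) f
  simp only [hconst] at hderiv
  have h0 := (hasDerivAt_const (0 : ℝ) _).unique hderiv
  have h1 := setIntegral_Sph_comp (n : ℝ) (rot hij 0) (killing i j f)
  exact h1.symm.trans h0.symm

theorem sum_sq_of_mem_Sph {x : EuclideanSpace ℝ ι} (hx : x ∈ Sph ι) : ∑ i, x i * x i = 1 := by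
  have h : ‖x‖ = 1 := hx
  have := EuclideanSpace.real_norm_sq_eq x
  rw [h] at this
  simp only [← sq, ← this, one_pow]

theorem sum_killing_mul_killing {x : EuclideanSpace ℝ ι} (hx : x ∈ Sph ι)
    (f g : EuclideanSpace ℝ ι → ℝ) :
    ∑ i, ∑ j, killing i j f x * killing i j g x = 2 * carre f g x := by
  have h : ∀ i j, killing i j f x * killing i j g x =
      x i * x i * (pd j f x * pd j g x) - x i * pd i g x * (x j * pd j f x) -
      x i * pd i f x * (x j * pd j g x) + pd i f x * pd i g x * (x j * x j) := by
    intro i j; simp only [killing]; ring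
  simp only [h, Finset.sum_add_distrib, Finset.sum_sub_distrib, ← Finset.mul_sum,
    ← Finset.sum_mul, sum_sq_of_mem_Sph hx, carre]
  ring

theorem killing_killing {f : EuclideanSpace ℝ ι → ℝ} (hf : PuncturedSmooth f)
    {x : EuclideanSpace ℝ ι} (hx : x ≠ 0) (i j : ι) :
    killing i j (killing i j f) x =
      x i * x i * pd j (pd j f) x + pd i (pd i f) x * (x j * x j)
      - x i * x j * pd j (pd i f) x - x j * x i * pd i (pd j f) x - x i * pd i f x
      - x j * pd j f x + (if i = j then 2 * (x i * pd i f x) else 0) := by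
  have h : ∀ k, pd k (killing i j f) x =
      x i * pd k (pd j f) x + pd j f x * (if i = k then 1 else 0) -
      (x j * pd k (pd i f) x + pd i f x * (if j = k then 1 else 0)) := by
    intro k
    have : killing i j f = fun y => y i * pd j f y - y j * pd i f y := rfl
    rw [this, pd_sub k ((PuncturedSmooth.coord i).mul (hf.pd j))
      ((PuncturedSmooth.coord j).mul (hf.pd i)) hx, pd_mul k (PuncturedSmooth.coord i) (hf.pd j) hx,
      pd_mul k (PuncturedSmooth.coord j) (hf.pd i) hx, pd_coord, pd_coord]
  rw [killing, h, h]
  rcases eq_or_ne i j with rfl | hij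
  · simp; ring
  · simp only [hij, hij.symm, if_true, if_false]; ring

theorem sum_killing_killing {n : ℕ} {f : EuclideanSpace ℝ (Fin (n + 1)) → ℝ}
    (hf : PuncturedSmooth f) {x : EuclideanSpace ℝ (Fin (n + 1))} (hx : x ∈ Sph (Fin (n + 1))) :
    ∑ i, ∑ j, killing i j (killing i j f) x =
      2 * (lapE f x - hessRad f x - n * ∑ i, x i * pd i f x) := by
  have hswap : ∑ i, ∑ j, x j * x i * pd i (pd j f) x = hessRad f x := Finset.sum_comm
  have hrad : ∑ i, ∑ j, x i * x j * pd j (pd i f) x = hessRad f x := rfl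
  have hlap : ∑ i, pd i (pd i f) x = lapE f x := rfl
  simp only [killing_killing hf (ne_zero_of_mem_Sph hx), Finset.sum_add_distrib,
    Finset.sum_sub_distrib, hswap, hrad, Finset.sum_ite_eq, Finset.mem_univ, if_true]
  simp only [← Finset.mul_sum, ← Finset.sum_mul, sum_sq_of_mem_Sph hx, hlap,
    Finset.sum_const, Finset.card_univ, Fintype.card_fin, nsmul_eq_mul,
    mul_left_comm _ (((n + 1 : ℕ) : ℝ)) _]
  push_cast
  ring

/-- Integration by parts on the sphere. -/
theorem integral_mul_laplacian {n : ℕ} {f g : EuclideanSpace ℝ (Fin (n + 1)) → ℝ}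
    (hf : PuncturedSmooth f) (hg : PuncturedSmooth g) :
    ∫ x in Sph (Fin (n + 1)), (g x * (lapE f x - hessRad f x - n * ∑ i, x i * pd i f x) +
      carre g f x) ∂(Measure.hausdorffMeasure (n : ℝ)) = 0 := by
  have h : ∀ i j, ∫ x in Sph (Fin (n + 1)), killing i j (fun y => g y * killing i j f y) x
      ∂(Measure.hausdorffMeasure (n : ℝ)) = 0 := fun i j =>
    integral_killing i j (hg.mul (hf.killing i j))
  have hint : ∀ i j, IntegrableOn (killing i j (fun y => g y * killing i j f y))
      (Sph (Fin (n + 1))) (Measure.hausdorffMeasure (n : ℝ)) := fun i j =>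
    integrableOn_Sph ((hg.mul (hf.killing i j)).killing i j).continuousOn_Sph
  have hpt : ∀ x ∈ Sph (Fin (n + 1)), g x * (lapE f x - hessRad f x - n * ∑ i, x i * pd i f x) +
      carre g f x = (1 / 2) * ∑ i, ∑ j, killing i j (fun y => g y * killing i j f y) x := by
    intro x hx
    have hx0 := ne_zero_of_mem_Sph hx
    have hprod : ∀ i j, killing i j (fun y => g y * killing i j f y) x =
        g x * killing i j (killing i j f) x + killing i j g x * killing i j f x := by
      intro i j
      rw [killing, pd_mul j hg (hf.killing i j) hx0, pd_mul i hg (hf.killing i j) hx0]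
      simp only [killing]
      ring
    simp only [hprod, Finset.sum_add_distrib, sum_killing_mul_killing hx, ← Finset.mul_sum,
      sum_killing_killing hf hx]
    ring
  rw [setIntegral_congr_fun (measurableSet_Sph _) hpt, integral_const_mul,
    integral_finsetSum _ fun i _ => integrable_finsetSum _ fun j _ => hint i j]
  simp only [integral_finsetSum _ fun j _ => hint _ j, h, Finset.sum_const_zero, mul_zero]

theorem integral_mul_laplacian_of_isHom {n : ℕ} {f g : EuclideanSpace ℝ (Fin (n + 1)) → ℝ} {m : ℤ}
    (hf : PuncturedSmooth f) (hg : PuncturedSmooth g) (hm : IsHom m f) :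
    ∫ x in Sph (Fin (n + 1)), (g x * lapE f x + carre g f x) ∂(Measure.hausdorffMeasure (n : ℝ)) =
      m * (m - 1 + n) * ∫ x in Sph (Fin (n + 1)), g x * f x ∂(Measure.hausdorffMeasure (n : ℝ)) := by
  rw [← sub_eq_zero, ← integral_const_mul, ← integral_sub
    (integrableOn_Sph ((hg.mul hf.lapE).add (hg.carre hf)).continuousOn_Sph)
    ((integrableOn_Sph (hg.mul hf).continuousOn_Sph).const_mul _), ← integral_mul_laplacian hf hg]
  refine setIntegral_congr_fun (measurableSet_Sph _) fun x hx => ?_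
  simp only [hm.hessRad hf (ne_zero_of_mem_Sph hx), hm.sum_mul_pd hf (ne_zero_of_mem_Sph hx)]
  ring

/-! ### The second variation -/

/-- The integrand of the second variation at `p + q * I` in the direction `v + w * I`. -/
def quadGL (ε : ℝ) (p q v w : EuclideanSpace ℝ ι → ℝ) (x : EuclideanSpace ℝ ι) : ℝ :=
  carre v v x + carre w w x + (p x * p x + q x * q x - 1) / ε ^ 2 * (v x * v x + w x * w x) +
    2 / ε ^ 2 * (p x * v x + q x * w x) ^ 2

/-- The right-hand side of the Ginzburg–Landau equation for the component `f` of `p + q * I`. -/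
def potGL (ε : ℝ) (p q f : EuclideanSpace ℝ ι → ℝ) (x : EuclideanSpace ℝ ι) : ℝ :=
  (ε ^ 2)⁻¹ * ((p x * p x + q x * q x - 1) * f x)

theorem PuncturedSmooth.quadGL (ε : ℝ) {p q v w : EuclideanSpace ℝ ι → ℝ} (hp : PuncturedSmooth p)
    (hq : PuncturedSmooth q) (hv : PuncturedSmooth v) (hw : PuncturedSmooth w) :
    PuncturedSmooth (quadGL ε p q v w) := by
  have h1 := ((((hp.mul hp).add (hq.mul hq)).sub (.const 1)).mul (.const (ε ^ 2)⁻¹)).mul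
    ((hv.mul hv).add (hw.mul hw))
  exact ((((hv.carre hv).add (hw.carre hw)).add h1).add
    ((PuncturedSmooth.const (2 / ε ^ 2)).mul (((hp.mul hv).add (hq.mul hw)).pow 2)))

theorem PuncturedSmooth.potGL (ε : ℝ) {p q f : EuclideanSpace ℝ ι → ℝ} (hp : PuncturedSmooth p)
    (hq : PuncturedSmooth q) (hf : PuncturedSmooth f) : PuncturedSmooth (potGL ε p q f) :=
  (PuncturedSmooth.const (ε ^ 2)⁻¹).mul ((((hp.mul hp).add (hq.mul hq)).sub (.const 1)).mul hf)

theorem IsHom.potGL (ε : ℝ) {p q f : EuclideanSpace ℝ ι → ℝ} (hp : IsHom 0 p)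
    (hq : IsHom 0 q) (hf : IsHom 0 f) : IsHom 0 (potGL ε p q f) := by
  intro c hc x hx
  simp only [_root_.potGL, hp c hc x hx, hq c hc x hx, hf c hc x hx, zpow_zero, one_mul]

theorem carre_comm (f g : EuclideanSpace ℝ ι → ℝ) (x : EuclideanSpace ℝ ι) :
    carre f g x = carre g f x := by
  simp only [carre, mul_comm (pd _ f x), mul_comm (∑ i, x i * pd i f x)]

theorem inner_gradient_eq (f : EuclideanSpace ℝ ι → ℝ) (x y : EuclideanSpace ℝ ι) :
    ⟪_root_.gradient f x, y⟫ = fderiv ℝ f x y := by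
  simp

theorem gradient_coord (f : EuclideanSpace ℝ ι → ℝ) (x : EuclideanSpace ℝ ι) (i : ι) :
    _root_.gradient f x i = pd i f x := by
  rw [pd, ← inner_gradient_eq, EuclideanSpace.inner_single_right]
  simp

theorem norm_gradS_sq (f : EuclideanSpace ℝ ι → ℝ) {x : EuclideanSpace ℝ ι} (hx : x ∈ Sph ι) :
    ‖gradS f x‖ ^ 2 = carre f f x := by
  have h1 : ‖x‖ = 1 := hx
  rw [gradS, norm_sub_sq_real, norm_smul, h1, real_inner_smul_right, mul_one, Real.norm_eq_abs,
    sq_abs, EuclideanSpace.real_norm_sq_eq, inner_gradient_eq, fderiv_apply_eq_sum_pd, carre]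
  simp only [gradient_coord, ← sq]
  ring

theorem gradS_eventuallyEq {f : EuclideanSpace ℝ ι → ℝ} (hf : PuncturedSmooth f) (h0 : IsHom 0 f)
    {x : EuclideanSpace ℝ ι} (hx : x ≠ 0) : gradS f =ᶠ[nhds x] _root_.gradient f := by
  filter_upwards [eventually_punctured hx] with y hy
  rw [gradS, inner_gradient_eq, fderiv_apply_eq_sum_pd, h0.sum_mul_pd hf hy]
  simp

theorem lapS_eq_lapE {f : EuclideanSpace ℝ ι → ℝ} (hf : PuncturedSmooth f) (h0 : IsHom 0 f)
    {x : EuclideanSpace ℝ ι} (hx : x ≠ 0) : lapS f x = lapE f x := by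
  have hd : DifferentiableAt ℝ (_root_.gradient f) x := by
    rw [differentiableAt_euclidean]
    intro i
    simp only [gradient_coord]
    exact (hf.pd i).differentiableAt hx
  have key : ∀ y i, fderiv ℝ (gradS f) x y i = fderiv ℝ (pd i f) x y := by
    intro y i
    rw [(gradS_eventuallyEq hf h0 hx).fderiv_eq]
    have h := ((EuclideanSpace.proj (𝕜 := ℝ) i : EuclideanSpace ℝ ι →L[ℝ] ℝ).hasFDerivAt
      (x := _root_.gradient f x)).comp x hd.hasFDerivAt
    have h2 : (EuclideanSpace.proj (𝕜 := ℝ) i : EuclideanSpace ℝ ι →L[ℝ] ℝ) ∘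
        _root_.gradient f = pd i f := funext fun z => gradient_coord f z i
    rw [h2] at h
    rw [h.fderiv]
    rfl
  have hrad : ⟪fderiv ℝ (gradS f) x x, x⟫ = 0 := by
    have : ∀ i, fderiv ℝ (gradS f) x x i = - pd i f x := by
      intro i
      rw [key, fderiv_apply_eq_sum_pd, (h0.pd i).sum_mul_pd (hf.pd i) hx]
      simp
    simp only [PiLp.inner_apply, this, RCLike.inner_apply, conj_trivial, mul_neg,
      Finset.sum_neg_distrib]
    rw [h0.sum_mul_pd hf hx]
    simp
  rw [lapS, divS, hrad, sub_zero, lapE]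
  refine Finset.sum_congr rfl fun i _ => ?_
  rw [EuclideanSpace.inner_single_right, key]
  simp [pd]

/-- A smooth cutoff that vanishes near the origin and is `1` near the unit sphere. -/
def cutoff (x : EuclideanSpace ℝ ι) : ℝ := Real.smoothTransition (4 * ‖x‖ ^ 2 - 1)

theorem contDiff_cutoff_mul {f : EuclideanSpace ℝ ι → ℝ} (hf : PuncturedSmooth f) :
    ContDiff ℝ (⊤ : ℕ∞) fun x => cutoff x * f x := by
  rw [contDiff_iff_contDiffAt]
  intro x
  rcases eq_or_ne x 0 with rfl | hx
  · have : (fun x => cutoff x * f x) =ᶠ[nhds (0 : EuclideanSpace ℝ ι)] fun _ => 0 := by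
      filter_upwards [Metric.ball_mem_nhds (0 : EuclideanSpace ℝ ι) (half_pos one_pos)] with y hy
      have hy1 : ‖y‖ < 1 / 2 := by simpa using hy
      rw [cutoff, Real.smoothTransition.zero_of_nonpos (by nlinarith [norm_nonneg y]), zero_mul]
    exact contDiffAt_const.congr_of_eventuallyEq this
  · refine ContDiffAt.mul ?_ (hf.contDiffAt hx)
    have : ContDiff ℝ (⊤ : ℕ∞) fun x : EuclideanSpace ℝ ι => 4 * ‖x‖ ^ 2 - 1 :=
      (contDiff_const.mul (contDiff_norm_sq ℝ)).sub contDiff_const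
    exact (Real.smoothTransition.contDiff.comp this).contDiffAt

theorem cutoff_mul_eventuallyEq (f : EuclideanSpace ℝ ι → ℝ) {x : EuclideanSpace ℝ ι}
    (hx : x ∈ Sph ι) : (fun x => cutoff x * f x) =ᶠ[nhds x] f := by
  have h1 : ‖x‖ = 1 := hx
  have hev : ∀ᶠ y in nhds x, 3 / 4 < ‖y‖ :=
    continuous_norm.continuousAt.eventually_const_lt (by simp only [h1]; norm_num)
  filter_upwards [hev] with y hy
  rw [cutoff, Real.smoothTransition.one_of_one_le (by nlinarith), one_mul]

theorem carre_congr {f g : EuclideanSpace ℝ ι → ℝ} {x : EuclideanSpace ℝ ι}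
    (h : f =ᶠ[nhds x] g) : carre f f x = carre g g x := by
  simp only [carre, h.pd_eq]

/-- Stability tested against variations that are only smooth away from the origin. -/
theorem IsStable.integral_quadGL_nonneg {d ε : ℝ} {u : EuclideanSpace ℝ ι → ℂ}
    (h : IsStable d ε u) {v w : EuclideanSpace ℝ ι → ℝ} (hv : PuncturedSmooth v)
    (hw : PuncturedSmooth w) :
    0 ≤ ∫ x in Sph ι, quadGL ε (uRe u) (uIm u) v w x ∂(Measure.hausdorffMeasure d) := by
  set V : EuclideanSpace ℝ ι → ℂ := fun x =>
    ((cutoff x * v x : ℝ) : ℂ) + ((cutoff x * w x : ℝ) : ℂ) * Complex.I with hV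
  have hVs : ContDiff ℝ (⊤ : ℕ∞) V :=
    (Complex.ofRealCLM.contDiff.comp (contDiff_cutoff_mul hv)).add
      ((Complex.ofRealCLM.contDiff.comp (contDiff_cutoff_mul hw)).mul contDiff_const)
  have hre : uRe V = fun x => cutoff x * v x := by
    funext x; simp [uRe, hV]
  have him : uIm V = fun x => cutoff x * w x := by
    funext x; simp [uIm, hV]
  have hd := h V hVs
  rw [d2E] at hd
  rwa [setIntegral_congr_fun (measurableSet_Sph ι) (g := quadGL ε (uRe u) (uIm u) v w)] at hd
  intro x hx
  have e1 := cutoff_mul_eventuallyEq v hx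
  have e2 := cutoff_mul_eventuallyEq w hx
  have v1 : (V x).re = v x := (congrFun hre x).trans e1.eq_of_nhds
  have v2 : (V x).im = w x := (congrFun him x).trans e2.eq_of_nhds
  simp only [gradSq, norm_gradS_sq _ hx, hre, him, carre_congr e1, carre_congr e2, Complex.sq_norm,
    Complex.normSq_apply, v1, v2, cdot, quadGL]
  rfl

/-! ### Consequences of the equation -/

theorem pd_potGL (ε : ℝ) {p q f : EuclideanSpace ℝ ι → ℝ} (hp : PuncturedSmooth p)
    (hq : PuncturedSmooth q) (hf : PuncturedSmooth f) {x : EuclideanSpace ℝ ι} (hx : x ≠ 0)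
    (a : ι) : pd a (potGL ε p q f) x = (ε ^ 2)⁻¹ * ((p x * p x + q x * q x - 1) * pd a f x +
      f x * (2 * (p x * pd a p x + q x * pd a q x))) := by
  have : potGL ε p q f = fun y => (ε ^ 2)⁻¹ * ((p y * p y + q y * q y - 1) * f y) := rfl
  rw [this, pd_mul a (.const _) ((((hp.mul hp).add (hq.mul hq)).sub (.const 1)).mul hf) hx,
    pd_mul a (((hp.mul hp).add (hq.mul hq)).sub (.const 1)) hf hx,
    pd_sub a ((hp.mul hp).add (hq.mul hq)) (.const 1) hx, pd_add a (hp.mul hp) (hq.mul hq) hx,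
    pd_mul a hp hp hx, pd_mul a hq hq hx, pd_const, pd_const]
  ring

/-- Differentiating the equation `Δ f = h` on the sphere. -/
theorem lapE_pd_eq {f h : EuclideanSpace ℝ ι → ℝ} (hf : PuncturedSmooth f) (hf0 : IsHom 0 f)
    (hh0 : IsHom 0 h) (heq : ∀ x ∈ Sph ι, lapE f x = h x)
    {x : EuclideanSpace ℝ ι} (hx : x ∈ Sph ι) (a : ι) :
    lapE (pd a f) x = pd a h x - 2 * x a * h x := by
  have hx0 := ne_zero_of_mem_Sph hx
  have hext : ∀ y : EuclideanSpace ℝ ι, y ≠ 0 → (∑ i, y i * y i) * lapE f y = h y := by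
    intro y hy
    have hpos : 0 < ‖y‖ := norm_pos_iff.2 hy
    have hmem : ‖y‖⁻¹ • y ∈ Sph ι := by
      simp [Sph, norm_smul, hpos.ne']
    have h1 := heq _ hmem
    rw [hh0 _ (inv_pos.2 hpos) y hy, hf0.lapE _ (inv_pos.2 hpos) y hy] at h1
    have h2 : ∑ i, y i * y i = ‖y‖ ^ 2 := by
      simp only [EuclideanSpace.real_norm_sq_eq, ← sq]
    have h3 : (‖y‖⁻¹ : ℝ) ^ ((0 : ℤ) - 2) = ‖y‖ ^ 2 := by
      rw [zero_sub, inv_zpow, zpow_neg, inv_inv]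
      norm_cast
    rw [h2, ← h3, h1]
    simp
  have hev : (fun y : EuclideanSpace ℝ ι => (∑ i, y i * y i) * lapE f y) =ᶠ[nhds x] h := by
    filter_upwards [eventually_punctured hx0] with y hy using hext y hy
  have h1 := hev.pd_eq (i := a)
  have hsm : ∀ i ∈ Finset.univ, PuncturedSmooth fun y : EuclideanSpace ℝ ι => y i * y i :=
    fun i _ => (PuncturedSmooth.coord i).mul (.coord i)
  rw [pd_mul a (.sum hsm) hf.lapE hx0, pd_sum _ a hsm hx0, sum_sq_of_mem_Sph hx,
    pd_lapE a hf hx0, heq x hx] at h1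
  have h2 : ∑ i, pd a (fun y : EuclideanSpace ℝ ι => y i * y i) x = 2 * x a := by
    simp only [pd_mul a (PuncturedSmooth.coord _) (PuncturedSmooth.coord _) hx0, pd_coord]
    simp [two_mul, Finset.sum_add_distrib]
  rw [h2] at h1
  linarith

theorem carre_add_mul {f g : EuclideanSpace ℝ ι → ℝ} (hf : PuncturedSmooth f)
    (hg : PuncturedSmooth g) (t : ℝ) {x : EuclideanSpace ℝ ι} (hx : x ≠ 0) :
    carre (fun y => f y + t * g y) (fun y => f y + t * g y) x =
      carre f f x + 2 * t * carre f g x + t ^ 2 * carre g g x := by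
  have h : ∀ i, pd i (fun y => f y + t * g y) x = pd i f x + t * pd i g x := by
    intro i
    rw [pd_add i hf ((PuncturedSmooth.const t).mul hg) hx, pd_mul i (.const t) hg hx, pd_const]
    ring
  have h1 : ∀ i, (pd i f x + t * pd i g x) * (pd i f x + t * pd i g x) =
      pd i f x * pd i f x + 2 * t * (pd i f x * pd i g x) + t ^ 2 * (pd i g x * pd i g x) := by
    intro i; ring
  have h2 : ∀ i, x i * (pd i f x + t * pd i g x) = x i * pd i f x + t * (x i * pd i g x) := by
    intro i; ring
  simp only [carre, h, h1, h2, Finset.sum_add_distrib, ← Finset.mul_sum]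
  ring

theorem sum_carre_pd_coord_mul {f h : EuclideanSpace ℝ ι → ℝ} (hf : PuncturedSmooth f)
    (hf0 : IsHom 0 f) (hh : PuncturedSmooth h) (hh0 : IsHom 0 h)
    {x : EuclideanSpace ℝ ι} (hx : x ∈ Sph ι) :
    ∑ a, carre (pd a f) (fun y => y a * h y) x = h x * lapE f x - carre f h x := by
  have hx0 := ne_zero_of_mem_Sph hx
  have hpd : ∀ a i, pd i (fun y : EuclideanSpace ℝ ι => y a * h y) x =
      x a * pd i h x + h x * (if a = i then 1 else 0) := by
    intro a i
    rw [pd_mul i (.coord a) hh hx0, pd_coord]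
  have hrad : ∀ a, ∑ i, x i * pd i (fun y : EuclideanSpace ℝ ι => y a * h y) x = x a * h x := by
    intro a
    have h1 : ∀ i, x i * (x a * pd i h x + h x * (if a = i then 1 else 0)) =
        x a * (x i * pd i h x) + (if a = i then x i * h x else 0) := by
      intro i; split_ifs <;> ring
    simp only [hpd, h1, Finset.sum_add_distrib, ← Finset.mul_sum, hh0.sum_mul_pd hh hx0,
      Finset.sum_ite_eq, Finset.mem_univ, if_true]
    simp
  have hrad2 : ∀ a, ∑ i, x i * pd i (pd a f) x = - pd a f x := by
    intro a
    rw [(hf0.pd a).sum_mul_pd (hf.pd a) hx0]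
    simp
  have hmain : ∀ a i, pd i (pd a f) x * (x a * pd i h x + h x * (if a = i then 1 else 0)) =
      x a * pd a (pd i f) x * pd i h x + (if a = i then h x * pd i (pd a f) x else 0) := by
    intro a i
    rw [pd_comm i a hf hx0]
    split_ifs <;> ring
  have hsum : ∑ a, ∑ i, x a * pd a (pd i f) x * pd i h x = - ∑ i, pd i f x * pd i h x := by
    rw [Finset.sum_comm]
    simp only [← Finset.sum_mul, hrad2, neg_mul, Finset.sum_neg_distrib]
  have hcross : ∀ a, -pd a f x * (x a * h x) = - (h x * (x a * pd a f x)) := by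
    intro a; ring
  simp only [carre, hrad, hrad2]
  simp only [Finset.sum_sub_distrib, hpd, hmain, Finset.sum_add_distrib, hsum,
    Finset.sum_ite_eq, Finset.mem_univ, if_true, hcross, Finset.sum_neg_distrib, ← Finset.mul_sum,
    hf0.sum_mul_pd hf hx0, lapE]
  simp
  ring

/-- The sum over all `a` of the second variation in the directions `∂_a u + t x_a Δu`. -/
theorem sum_quadGL {ε : ℝ} {p q : EuclideanSpace ℝ ι → ℝ} (hp : PuncturedSmooth p)
    (hq : PuncturedSmooth q) (hp0 : IsHom 0 p) (hq0 : IsHom 0 q)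
    (hpe : ∀ x ∈ Sph ι, lapE p x = potGL ε p q p x)
    (hqe : ∀ x ∈ Sph ι, lapE q x = potGL ε p q q x) (t : ℝ)
    {x : EuclideanSpace ℝ ι} (hx : x ∈ Sph ι) :
    ∑ a, quadGL ε p q (fun y => pd a p y + t * (y a * potGL ε p q p y))
        (fun y => pd a q y + t * (y a * potGL ε p q q y)) x =
      ∑ a, ((pd a p x * lapE (pd a p) x + carre (pd a p) (pd a p) x) +
        (pd a q x * lapE (pd a q) x + carre (pd a q) (pd a q) x)) +
      2 * t * ((potGL ε p q p x * lapE p x - carre p (potGL ε p q p) x) +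
        (potGL ε p q q x * lapE q x - carre q (potGL ε p q q) x)) +
      t ^ 2 * ∑ a, quadGL ε p q (fun y => y a * potGL ε p q p y)
        (fun y => y a * potGL ε p q q y) x := by
  have hx0 := ne_zero_of_mem_Sph hx
  have hP := PuncturedSmooth.potGL ε hp hq hp
  have hQ := PuncturedSmooth.potGL ε hp hq hq
  have hP0 := IsHom.potGL ε hp0 hq0 hp0
  have hQ0 := IsHom.potGL ε hp0 hq0 hq0
  have hterm : ∀ a, quadGL ε p q (fun y => pd a p y + t * (y a * potGL ε p q p y))
        (fun y => pd a q y + t * (y a * potGL ε p q q y)) x =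
      ((pd a p x * lapE (pd a p) x + carre (pd a p) (pd a p) x) +
        (pd a q x * lapE (pd a q) x + carre (pd a q) (pd a q) x)) +
      2 * t * (carre (pd a p) (fun y => y a * potGL ε p q p y) x +
        carre (pd a q) (fun y => y a * potGL ε p q q y) x) +
      t ^ 2 * quadGL ε p q (fun y => y a * potGL ε p q p y) (fun y => y a * potGL ε p q q y) x +
      (2 * potGL ε p q p x + 2 * t * (ε ^ 2)⁻¹ * ((p x * p x + q x * q x - 1) * potGL ε p q p x +
        2 * p x * (p x * potGL ε p q p x + q x * potGL ε p q q x))) * (x a * pd a p x) +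
      (2 * potGL ε p q q x + 2 * t * (ε ^ 2)⁻¹ * ((p x * p x + q x * q x - 1) * potGL ε p q q x +
        2 * q x * (p x * potGL ε p q p x + q x * potGL ε p q q x))) * (x a * pd a q x) := by
    intro a
    rw [lapE_pd_eq hp hp0 hP0 hpe hx a, lapE_pd_eq hq hq0 hQ0 hqe hx a, pd_potGL ε hp hq hp hx0,
      pd_potGL ε hp hq hq hx0]
    simp only [quadGL, carre_add_mul (hp.pd a) ((PuncturedSmooth.coord a).mul hP) t hx0,
      carre_add_mul (hq.pd a) ((PuncturedSmooth.coord a).mul hQ) t hx0]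
    ring
  simp only [hterm]
  simp only [Finset.sum_add_distrib, ← Finset.mul_sum, hp0.sum_mul_pd hp hx0,
    hq0.sum_mul_pd hq hx0, sum_carre_pd_coord_mul hp hp0 hP hP0 hx,
    sum_carre_pd_coord_mul hq hq0 hQ hQ0 hx]
  simp

/-! ### Stable solutions -/

theorem PuncturedSmooth.integrableOn_Sph {n : ℕ} {f : EuclideanSpace ℝ (Fin (n + 1)) → ℝ}
    (hf : PuncturedSmooth f) :
    IntegrableOn f (Sph (Fin (n + 1))) (Measure.hausdorffMeasure (n : ℝ)) :=
  _root_.integrableOn_Sph hf.continuousOn_Sph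

theorem integral_pd_mul_lapE_nonpos {n : ℕ} (hn : 2 ≤ n) {f : EuclideanSpace ℝ (Fin (n + 1)) → ℝ}
    (hf : PuncturedSmooth f) (hf0 : IsHom 0 f) (a : Fin (n + 1)) :
    ∫ x in Sph (Fin (n + 1)), (pd a f x * lapE (pd a f) x + carre (pd a f) (pd a f) x)
      ∂(Measure.hausdorffMeasure (n : ℝ)) ≤ 0 := by
  rw [integral_mul_laplacian_of_isHom (hf.pd a) (hf.pd a) (hf0.pd a)]
  have h1 : 0 ≤ ∫ x in Sph (Fin (n + 1)), pd a f x * pd a f x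
      ∂(Measure.hausdorffMeasure (n : ℝ)) := integral_nonneg fun x => mul_self_nonneg _
  have h2 : (2 : ℝ) ≤ n := by exact_mod_cast hn
  refine mul_nonpos_of_nonpos_of_nonneg ?_ h1
  push_cast
  linarith

theorem integral_mul_lapE_sub_carre {n : ℕ} {f h : EuclideanSpace ℝ (Fin (n + 1)) → ℝ}
    (hf : PuncturedSmooth f) (hf0 : IsHom 0 f) (hh : PuncturedSmooth h)
    (heq : ∀ x ∈ Sph (Fin (n + 1)), lapE f x = h x) :
    ∫ x in Sph (Fin (n + 1)), (h x * lapE f x - carre f h x)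
      ∂(Measure.hausdorffMeasure (n : ℝ)) =
      2 * ∫ x in Sph (Fin (n + 1)), h x * h x ∂(Measure.hausdorffMeasure (n : ℝ)) := by
  have h1 := integral_mul_laplacian_of_isHom hf hh hf0
  rw [Int.cast_zero, zero_mul, zero_mul] at h1
  rw [← sub_zero (∫ x in Sph (Fin (n + 1)), (h x * lapE f x - carre f h x)
    ∂(Measure.hausdorffMeasure (n : ℝ))), ← neg_zero, ← h1, sub_neg_eq_add,
    ← integral_add ((hh.mul hf.lapE).sub (hf.carre hh)).integrableOn_Sph
      ((hh.mul hf.lapE).add (hh.carre hf)).integrableOn_Sph, ← integral_const_mul]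
  refine setIntegral_congr_fun (measurableSet_Sph _) fun x hx => ?_
  simp only [heq x hx, carre_comm f h x]
  ring

theorem potGL_eq_zero {n : ℕ} (hn : 2 ≤ n) {ε : ℝ} {p q : EuclideanSpace ℝ (Fin (n + 1)) → ℝ}
    (hp : PuncturedSmooth p) (hq : PuncturedSmooth q) (hp0 : IsHom 0 p) (hq0 : IsHom 0 q)
    (hpe : ∀ x ∈ Sph (Fin (n + 1)), lapE p x = potGL ε p q p x)
    (hqe : ∀ x ∈ Sph (Fin (n + 1)), lapE q x = potGL ε p q q x)
    (hstab : ∀ v w, PuncturedSmooth v → PuncturedSmooth w →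
      0 ≤ ∫ x in Sph (Fin (n + 1)), quadGL ε p q v w x ∂(Measure.hausdorffMeasure (n : ℝ))) :
    ∀ x ∈ Sph (Fin (n + 1)), potGL ε p q p x = 0 ∧ potGL ε p q q x = 0 := by
  have hP := PuncturedSmooth.potGL ε hp hq hp
  have hQ := PuncturedSmooth.potGL ε hp hq hq
  set I := ∫ x in Sph (Fin (n + 1)), (potGL ε p q p x * potGL ε p q p x +
    potGL ε p q q x * potGL ε p q q x) ∂(Measure.hausdorffMeasure (n : ℝ)) with hI
  set C := ∫ x in Sph (Fin (n + 1)), (∑ a, quadGL ε p q (fun y => y a * potGL ε p q p y)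
    (fun y => y a * potGL ε p q q y) x) ∂(Measure.hausdorffMeasure (n : ℝ)) with hC
  have hI0 : 0 ≤ I := integral_nonneg fun x => add_nonneg (mul_self_nonneg _) (mul_self_nonneg _)
  have hpA : ∀ a, PuncturedSmooth fun x =>
      pd a p x * lapE (pd a p) x + carre (pd a p) (pd a p) x := fun a =>
    ((hp.pd a).mul (hp.pd a).lapE).add ((hp.pd a).carre (hp.pd a))
  have hqA : ∀ a, PuncturedSmooth fun x =>
      pd a q x * lapE (pd a q) x + carre (pd a q) (pd a q) x := fun a =>
    ((hq.pd a).mul (hq.pd a).lapE).add ((hq.pd a).carre (hq.pd a))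
  have hpB := (hP.mul hp.lapE).sub (hp.carre hP)
  have hqB := (hQ.mul hq.lapE).sub (hq.carre hQ)
  have hA : ∫ x in Sph (Fin (n + 1)), (∑ a,
      ((pd a p x * lapE (pd a p) x + carre (pd a p) (pd a p) x) +
        (pd a q x * lapE (pd a q) x + carre (pd a q) (pd a q) x)))
      ∂(Measure.hausdorffMeasure (n : ℝ)) ≤ 0 := by
    rw [integral_finsetSum _ fun a _ => ((hpA a).add (hqA a)).integrableOn_Sph]
    refine Finset.sum_nonpos fun a _ => ?_
    rw [integral_add (hpA a).integrableOn_Sph (hqA a).integrableOn_Sph]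
    exact add_nonpos (integral_pd_mul_lapE_nonpos hn hp hp0 a)
      (integral_pd_mul_lapE_nonpos hn hq hq0 a)
  have hB : ∫ x in Sph (Fin (n + 1)),
      ((potGL ε p q p x * lapE p x - carre p (potGL ε p q p) x) +
        (potGL ε p q q x * lapE q x - carre q (potGL ε p q q) x))
      ∂(Measure.hausdorffMeasure (n : ℝ)) = 2 * I := by
    rw [integral_add hpB.integrableOn_Sph hqB.integrableOn_Sph,
      integral_mul_lapE_sub_carre hp hp0 hP hpe, integral_mul_lapE_sub_carre hq hq0 hQ hqe, hI,
      integral_add (hP.mul hP).integrableOn_Sph (hQ.mul hQ).integrableOn_Sph, mul_add]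
  have hCs : PuncturedSmooth fun x => ∑ a, quadGL ε p q (fun y => y a * potGL ε p q p y)
      (fun y => y a * potGL ε p q q y) x := .sum fun a _ =>
    .quadGL ε hp hq ((PuncturedSmooth.coord a).mul hP) ((PuncturedSmooth.coord a).mul hQ)
  have hAs : PuncturedSmooth fun x => ∑ a,
      ((pd a p x * lapE (pd a p) x + carre (pd a p) (pd a p) x) +
        (pd a q x * lapE (pd a q) x + carre (pd a q) (pd a q) x)) :=
    .sum fun a _ => (hpA a).add (hqA a)
  have hquad : ∀ t : ℝ, 0 ≤ 4 * t * I + t ^ 2 * C := by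
    intro t
    have hv : ∀ a, PuncturedSmooth fun y => pd a p y + t * (y a * potGL ε p q p y) := fun a =>
      (hp.pd a).add ((PuncturedSmooth.const t).mul ((PuncturedSmooth.coord a).mul hP))
    have hw : ∀ a, PuncturedSmooth fun y => pd a q y + t * (y a * potGL ε p q q y) := fun a =>
      (hq.pd a).add ((PuncturedSmooth.const t).mul ((PuncturedSmooth.coord a).mul hQ))
    have h1 : 0 ≤ ∑ a, ∫ x in Sph (Fin (n + 1)),
        quadGL ε p q (fun y => pd a p y + t * (y a * potGL ε p q p y))
          (fun y => pd a q y + t * (y a * potGL ε p q q y)) x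
        ∂(Measure.hausdorffMeasure (n : ℝ)) :=
      Finset.sum_nonneg fun a _ => hstab _ _ (hv a) (hw a)
    rw [← integral_finsetSum _ fun a _ =>
        (PuncturedSmooth.quadGL ε hp hq (hv a) (hw a)).integrableOn_Sph,
      setIntegral_congr_fun (measurableSet_Sph _)
        fun x hx => sum_quadGL hp hq hp0 hq0 hpe hqe t hx,
      integral_add (hAs.add ((PuncturedSmooth.const (2 * t)).mul (hpB.add hqB))).integrableOn_Sph
        ((PuncturedSmooth.const (t ^ 2)).mul hCs).integrableOn_Sph,
      integral_add hAs.integrableOn_Sph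
        ((PuncturedSmooth.const (2 * t)).mul (hpB.add hqB)).integrableOn_Sph,
      integral_const_mul, integral_const_mul, hB] at h1
    linarith
  have hIz : I = 0 := by
    by_contra hne
    have hpos : 0 < I := lt_of_le_of_ne hI0 (Ne.symm hne)
    have hd : 0 < |C| + 1 := by positivity
    have h1 := hquad (-(I / (|C| + 1)))
    have h2 : 0 < I / (|C| + 1) := div_pos hpos hd
    have h3 : I / (|C| + 1) * (|C| + 1) = I := div_mul_cancel₀ _ hd.ne'
    have h4 := le_abs_self C
    have h5 : I / (|C| + 1) * C ≤ I := by nlinarith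
    nlinarith
  intro x hx
  have h := eq_zero_of_setIntegral_Sph_eq_zero ((hP.mul hP).add (hQ.mul hQ)).continuousOn_Sph
    (fun x _ => add_nonneg (mul_self_nonneg _) (mul_self_nonneg _)) hIz x hx
  exact mul_self_add_mul_self_eq_zero.1 h

/-- Harmonic functions on the sphere are constant. -/
theorem exists_eq_const_of_lapE_eq_zero {n : ℕ} (hn : 2 ≤ n)
    {f : EuclideanSpace ℝ (Fin (n + 1)) → ℝ} (hf : PuncturedSmooth f) (hf0 : IsHom 0 f)
    (hlap : ∀ x ∈ Sph (Fin (n + 1)), lapE f x = 0) :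
    ∃ c, ∀ x ∈ Sph (Fin (n + 1)), f x = c := by
  have hcarre : ∀ x ∈ Sph (Fin (n + 1)), carre f f x = ∑ i, pd i f x * pd i f x := by
    intro x hx
    rw [carre, hf0.sum_mul_pd hf (ne_zero_of_mem_Sph hx)]
    simp
  have hI : ∫ x in Sph (Fin (n + 1)), (∑ i, pd i f x * pd i f x)
      ∂(Measure.hausdorffMeasure (n : ℝ)) = 0 := by
    have h1 := integral_mul_laplacian_of_isHom hf hf hf0
    rw [Int.cast_zero, zero_mul, zero_mul] at h1
    rw [← h1]
    refine setIntegral_congr_fun (measurableSet_Sph _) fun x hx => ?_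
    simp only [hlap x hx, hcarre x hx, mul_zero, zero_add]
  have hpd : ∀ x ∈ Sph (Fin (n + 1)), ∀ i, pd i f x = 0 := by
    intro x hx i
    have h := eq_zero_of_setIntegral_Sph_eq_zero
      (PuncturedSmooth.sum fun i _ => (hf.pd i).mul (hf.pd i)).continuousOn_Sph
      (fun x _ => Finset.sum_nonneg fun i _ => mul_self_nonneg _) hI x hx
    exact mul_self_eq_zero.1
      ((Finset.sum_eq_zero_iff_of_nonneg fun i _ => mul_self_nonneg _).1 h i (Finset.mem_univ i))
  have hfd : Set.EqOn (fderiv ℝ f) 0 {x | x ≠ 0} := by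
    intro x hx
    have hpos : 0 < ‖x‖ := norm_pos_iff.2 hx
    have hmem : ‖x‖⁻¹ • x ∈ Sph (Fin (n + 1)) := by
      simp [Sph, norm_smul, hpos.ne']
    ext y
    rw [fderiv_apply_eq_sum_pd]
    refine Finset.sum_eq_zero fun i _ => ?_
    have h := hpd _ hmem i
    rw [hf0.pd i _ (inv_pos.2 hpos) x hx] at h
    rw [(mul_eq_zero.1 h).resolve_left (zpow_ne_zero _ (inv_pos.2 hpos).ne'), mul_zero]
  have hconn : IsPreconnected {x : EuclideanSpace ℝ (Fin (n + 1)) | x ≠ 0} := by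
    refine (isConnected_compl_singleton_of_one_lt_rank ?_ 0).isPreconnected
    rw [← Module.finrank_eq_rank, finrank_euclideanSpace_fin]
    exact_mod_cast (by omega : 1 < n + 1)
  refine ⟨f (EuclideanSpace.single 0 1), fun x hx => ?_⟩
  exact isOpen_punctured.is_const_of_fderiv_eq_zero hconn
    (ContDiffOn.differentiableOn hf (by simp)) hfd (ne_zero_of_mem_Sph hx) (by simp)

theorem lapE_uRe_uIm {ε : ℝ} (hε : 0 < ε) {u : EuclideanSpace ℝ ι → ℂ} (h : IsGLSolution ε u) :
    PuncturedSmooth (uRe u) ∧ PuncturedSmooth (uIm u) ∧ IsHom 0 (uRe u) ∧ IsHom 0 (uIm u) ∧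
    (∀ x ∈ Sph ι, lapE (uRe u) x = potGL ε (uRe u) (uIm u) (uRe u) x) ∧
    ∀ x ∈ Sph ι, lapE (uIm u) x = potGL ε (uRe u) (uIm u) (uIm u) x := by
  obtain ⟨⟨hs, h0⟩, heq⟩ := h
  have hp : PuncturedSmooth (uRe u) := Complex.reCLM.contDiff.comp_contDiffOn hs
  have hq : PuncturedSmooth (uIm u) := Complex.imCLM.contDiff.comp_contDiffOn hs
  have hp0 : IsHom 0 (uRe u) := fun c hc x hx => by
    simp only [uRe, h0 c hc x hx, zpow_zero, one_mul]
  have hq0 : IsHom 0 (uIm u) := fun c hc x hx => by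
    simp only [uIm, h0 c hc x hx, zpow_zero, one_mul]
  have key : ∀ x ∈ Sph ι, ε ^ 2 * lapE (uRe u) x =
      (uRe u x * uRe u x + uIm u x * uIm u x - 1) * uRe u x ∧ ε ^ 2 * lapE (uIm u) x =
      (uRe u x * uRe u x + uIm u x * uIm u x - 1) * uIm u x := by
    intro x hx
    have h1 := heq x hx
    rw [lapSC, lapS_eq_lapE hp hp0 (ne_zero_of_mem_Sph hx),
      lapS_eq_lapE hq hq0 (ne_zero_of_mem_Sph hx), Complex.sq_norm, Complex.normSq_apply,
      ← Complex.ofReal_pow] at h1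
    have h2 := congrArg Complex.re h1
    have h3 := congrArg Complex.im h1
    rw [Complex.re_ofReal_mul, Complex.re_ofReal_mul] at h2
    rw [Complex.im_ofReal_mul, Complex.im_ofReal_mul] at h3
    refine ⟨Eq.trans (by simp) h2, Eq.trans (by simp) h3⟩
  have hne : ε ^ 2 ≠ 0 := by positivity
  refine ⟨hp, hq, hp0, hq0, fun x hx => ?_, fun x hx => ?_⟩
  · rw [potGL, ← (key x hx).1, inv_mul_cancel_left₀ hne]
  · rw [potGL, ← (key x hx).2, inv_mul_cancel_left₀ hne]

/-- Every stable solution of the Ginzburg–Landau equation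
`ε²Δu = (|u|²-1)u` on the round sphere `Sⁿ` (`n ≥ 2`) is constant with absolute value `1`,
regardless of the value of `ε > 0`.  (The sphere is realized as the unit sphere of
`ℝⁿ⁺¹`, functions on it via their 0-homogeneous ambient extensions; stability means
nonnegativity of the second outer variation `δ²E_ε(u)` on all smooth — hence, by density,
all `W^{1,2}` — variations `v : Sⁿ → ℂ`.) -/
theorem stmt11 (n : ℕ) (hn : 2 ≤ n) (ε : ℝ) (hε : 0 < ε)
    (u : EuclideanSpace ℝ (Fin (n + 1)) → ℂ)
    (hsol : IsGLSolution ε u) (hstab : IsStable (n : ℝ) ε u) :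
    ∃ c : ℂ, ‖c‖ = 1 ∧ ∀ x ∈ Sph (Fin (n + 1)), u x = c := by

  obtain ⟨hp, hq, hp0, hq0, hpe, hqe⟩ := lapE_uRe_uIm hε hsol
  have hε2 : 0 < ε ^ 2 := by positivity
  have hpot := potGL_eq_zero hn hp hq hp0 hq0 hpe hqe
    fun v w hv hw => hstab.integral_quadGL_nonneg hv hw
  obtain ⟨a, ha⟩ := exists_eq_const_of_lapE_eq_zero hn hp hp0
    fun x hx => (hpe x hx).trans (hpot x hx).1
  obtain ⟨b, hb⟩ := exists_eq_const_of_lapE_eq_zero hn hq hq0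
    fun x hx => (hqe x hx).trans (hpot x hx).2
  refine ⟨⟨a, b⟩, ?_, fun x hx => Complex.ext (ha x hx) (hb x hx)⟩
  suffices hab : a * a + b * b = 1 by
    rw [← sq_eq_sq₀ (norm_nonneg _) zero_le_one, Complex.sq_norm, Complex.normSq_apply, hab,
      one_pow]
  by_contra hne
  have hx1 : EuclideanSpace.single (0 : Fin (n + 1)) (1 : ℝ) ∈ Sph (Fin (n + 1)) := by
    simp [Sph]
  obtain ⟨h1, h2⟩ := hpot _ hx1
  rw [potGL, ha _ hx1, hb _ hx1] at h1 h2
  have hab1 := sub_ne_zero.2 hne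
  have ha0 : a = 0 := by simpa [hε.ne', hab1] using h1
  have hb0 : b = 0 := by simpa [hε.ne', hab1] using h2
  have hneg := hstab.integral_quadGL_nonneg (.const 1) (.const 0)
  rw [setIntegral_congr_fun (g := fun _ => -(ε ^ 2)⁻¹) (measurableSet_Sph _), setIntegral_const,
    smul_eq_mul] at hneg
  · have hpos : 0 < (Measure.hausdorffMeasure (n : ℝ)).real (Sph (Fin (n + 1))) :=
      ENNReal.toReal_pos (hausdorffMeasure_Sph_ne_zero n) (hausdorffMeasure_Sph_lt_top n).ne
    have := mul_pos hpos (inv_pos.2 hε2)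
    linarith
  · intro x hx
    simp only [quadGL, carre, pd_const, ha x hx, hb x hx, ha0, hb0]
    simp [neg_div]

end
end

section
/- Let u : S^2 → ℂ be a smooth stable solution of ε²Δu = (|u|²−1)u on the round 2-sphere, and suppose that for each i = 1, 2, 3 the function v_i = ⟨∇u, X_{ξ_i}⟩ lies in the kernel of the linearized operator, i.e., Δv_i = ((|u|²−1)/ε²)v_i + (2/ε²)(u·v_i)u. Then Δu ≡ 0 on S^2, and hence u is constant. -/
open MeasureTheory
open scoped RealInnerProductSpace

noncomputable section

/-! Basic spherical calculus on the unit sphere `S = {‖x‖ = 1} ⊂ ℝ^ι`, done via ambient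
(0-homogeneous) extensions.  The tangential gradient, divergence and the induced
Laplace–Beltrami operator are the standard ones of the round metric. -/

variable {ι : Type*} [Fintype ι] [DecidableEq ι]

section SphericalCalculus

variable {κ : Type*} [Fintype κ]

/-- Directional derivative of `f` along the constant vector `w`. -/
def dirDeriv (w : EuclideanSpace ℝ κ) (f : EuclideanSpace ℝ κ → ℝ)
    (x : EuclideanSpace ℝ κ) : ℝ := fderiv ℝ f x w

/-- Smoothness away from the origin. -/
def SmoothOffZero (f : EuclideanSpace ℝ κ → ℝ) : Prop :=
  ∀ x, x ≠ 0 → ContDiffAt ℝ (⊤ : ℕ∞) f x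

/-- Positive homogeneity of degree `k` away from the origin. -/
def HomogOffZero (k : ℤ) (f : EuclideanSpace ℝ κ → ℝ) : Prop :=
  ∀ c : ℝ, 0 < c → ∀ x : EuclideanSpace ℝ κ, x ≠ 0 → f (c • x) = c ^ k * f x

/-- The flat Laplacian of the ambient Euclidean space. -/
def flatLap [DecidableEq κ] (f : EuclideanSpace ℝ κ → ℝ) (x : EuclideanSpace ℝ κ) : ℝ :=
  ∑ i, dirDeriv (EuclideanSpace.single i 1) (dirDeriv (EuclideanSpace.single i 1) f) x

theorem eventually_ne_zero {x : EuclideanSpace ℝ κ} (hx : x ≠ 0) : ∀ᶠ y in nhds x, y ≠ 0 :=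
  isOpen_ne.mem_nhds hx

theorem dirDeriv_congr {f g : EuclideanSpace ℝ κ → ℝ} (h : ∀ y, y ≠ 0 → f y = g y)
    (w : EuclideanSpace ℝ κ) {x : EuclideanSpace ℝ κ} (hx : x ≠ 0) :
    dirDeriv w f x = dirDeriv w g x := by
  have : f =ᶠ[nhds x] g := (eventually_ne_zero hx).mono h
  rw [dirDeriv, this.fderiv_eq, dirDeriv]

theorem dirDeriv_add {f g : EuclideanSpace ℝ κ → ℝ} {x : EuclideanSpace ℝ κ}
    (hf : DifferentiableAt ℝ f x) (hg : DifferentiableAt ℝ g x) (w : EuclideanSpace ℝ κ) :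
    dirDeriv w (fun y => f y + g y) x = dirDeriv w f x + dirDeriv w g x := by
  simp [dirDeriv, fderiv_fun_add hf hg]

theorem dirDeriv_mul {f g : EuclideanSpace ℝ κ → ℝ} {x : EuclideanSpace ℝ κ}
    (hf : DifferentiableAt ℝ f x) (hg : DifferentiableAt ℝ g x) (w : EuclideanSpace ℝ κ) :
    dirDeriv w (fun y => f y * g y) x = f x * dirDeriv w g x + dirDeriv w f x * g x := by
  simp [dirDeriv, fderiv_fun_mul hf hg, mul_comm]

theorem dirDeriv_inner (v w x : EuclideanSpace ℝ κ) :
    dirDeriv w (fun y => ⟪y, v⟫) x = ⟪w, v⟫ := by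
  have : (fun y : EuclideanSpace ℝ κ => ⟪y, v⟫) = innerSL ℝ v := by
    ext y; simp [real_inner_comm]
  rw [dirDeriv, this, ContinuousLinearMap.fderiv]
  simp [real_inner_comm]

theorem dirDeriv_norm_sq (w x : EuclideanSpace ℝ κ) :
    dirDeriv w (fun y => ‖y‖ ^ 2) x = 2 * ⟪x, w⟫ := by
  rw [dirDeriv, fderiv_norm_sq_apply]
  simp

theorem dirDeriv_norm (w : EuclideanSpace ℝ κ) {x : EuclideanSpace ℝ κ} (hx : x ≠ 0) :
    dirDeriv w (fun y => ‖y‖) x = ‖x‖⁻¹ * ⟪x, w⟫ := by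
  have hd : DifferentiableAt ℝ (fun y : EuclideanSpace ℝ κ => ‖y‖) x :=
    differentiableAt_id.norm ℝ hx
  have h := dirDeriv_norm_sq w x
  simp only [pow_two] at h
  rw [dirDeriv_mul hd hd] at h
  have : ‖x‖ ≠ 0 := norm_ne_zero_iff.2 hx
  field_simp
  linarith

theorem dirDeriv_inv_norm (w : EuclideanSpace ℝ κ) {x : EuclideanSpace ℝ κ} (hx : x ≠ 0) :
    dirDeriv w (fun y => ‖y‖⁻¹) x = -(‖x‖⁻¹ ^ 3 * ⟪x, w⟫) := by
  have hd : DifferentiableAt ℝ (fun y : EuclideanSpace ℝ κ => ‖y‖) x :=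
    differentiableAt_id.norm ℝ hx
  have h0 : ‖x‖ ≠ 0 := norm_ne_zero_iff.2 hx
  have h := dirDeriv_mul hd (hd.fun_inv h0) w
  rw [dirDeriv_congr (g := fun _ => (1 : ℝ))
    (fun y hy => mul_inv_cancel₀ (norm_ne_zero_iff.2 hy)) w hx, dirDeriv_norm w hx] at h
  simp only [dirDeriv, fderiv_fun_const, Pi.zero_apply, zero_apply] at h
  have h' : dirDeriv w (fun y => ‖y‖⁻¹) x = -(‖x‖⁻¹ * (‖x‖⁻¹ * ⟪x, w⟫ * ‖x‖⁻¹)) := by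
    rw [dirDeriv]
    field_simp at h ⊢
    linarith
  rw [h']
  ring

theorem dirDeriv_sum_single [DecidableEq κ] (f : EuclideanSpace ℝ κ → ℝ) (w x : EuclideanSpace ℝ κ) :
    dirDeriv w f x = ∑ i, w i * dirDeriv (EuclideanSpace.single i 1) f x := by
  have hw : w = ∑ i, w i • EuclideanSpace.single i (1 : ℝ) := by
    ext j
    simp [Finset.sum_apply, Pi.single_apply]
  conv_lhs => rw [hw]
  simp [dirDeriv, map_sum]

namespace SmoothOffZero

variable {f g : EuclideanSpace ℝ κ → ℝ}

theorem differentiableAt (hf : SmoothOffZero f) {x : EuclideanSpace ℝ κ} (hx : x ≠ 0) :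
    DifferentiableAt ℝ f x :=
  (hf x hx).differentiableAt (by simp)

theorem add (hf : SmoothOffZero f) (hg : SmoothOffZero g) :
    SmoothOffZero fun y => f y + g y := fun x hx => (hf x hx).add (hg x hx)

theorem mul (hf : SmoothOffZero f) (hg : SmoothOffZero g) :
    SmoothOffZero fun y => f y * g y := fun x hx => (hf x hx).mul (hg x hx)

theorem fderiv (hf : SmoothOffZero f) {x : EuclideanSpace ℝ κ} (hx : x ≠ 0) :
    ContDiffAt ℝ (⊤ : ℕ∞) (fderiv ℝ f) x :=
  (hf x hx).fderiv_right (by simp)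

theorem dirDeriv (hf : SmoothOffZero f) (w : EuclideanSpace ℝ κ) :
    SmoothOffZero (dirDeriv w f) :=
  fun _ hx => (hf.fderiv hx).clm_apply contDiffAt_const

theorem norm : SmoothOffZero (fun y : EuclideanSpace ℝ κ => ‖y‖) :=
  fun _ hx => contDiffAt_norm ℝ hx

theorem inv_norm : SmoothOffZero (fun y : EuclideanSpace ℝ κ => ‖y‖⁻¹) :=
  fun x hx => (norm x hx).inv (norm_ne_zero_iff.2 hx)

theorem dirDeriv_dirDeriv (hf : SmoothOffZero f) (v w : EuclideanSpace ℝ κ)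
    {x : EuclideanSpace ℝ κ} (hx : x ≠ 0) :
    _root_.dirDeriv v (_root_.dirDeriv w f) x = _root_.fderiv ℝ (_root_.fderiv ℝ f) x v w := by
  have hd : DifferentiableAt ℝ (_root_.fderiv ℝ f) x :=
    (hf.fderiv hx).differentiableAt (by simp)
  change _root_.fderiv ℝ (fun y => _root_.fderiv ℝ f y w) x v = _
  rw [fderiv_clm_apply hd (differentiableAt_const _)]
  simp

theorem dirDeriv_comm (hf : SmoothOffZero f) (v w : EuclideanSpace ℝ κ)
    {x : EuclideanSpace ℝ κ} (hx : x ≠ 0) :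
    _root_.dirDeriv v (_root_.dirDeriv w f) x = _root_.dirDeriv w (_root_.dirDeriv v f) x := by
  rw [hf.dirDeriv_dirDeriv v w hx, hf.dirDeriv_dirDeriv w v hx]
  refine ((hf x hx).isSymmSndFDerivAt ?_) v w
  simp only [minSmoothness_of_isRCLikeNormedField]
  exact WithTop.coe_le_coe.2 le_top

theorem flatLap [DecidableEq κ] (hf : SmoothOffZero f) : SmoothOffZero (flatLap f) :=
  fun _ hx => ContDiffAt.sum fun _ _ => ((hf.dirDeriv _).dirDeriv _) _ hx

theorem dirDeriv_flatLap [DecidableEq κ] (hf : SmoothOffZero f) (w : EuclideanSpace ℝ κ)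
    {x : EuclideanSpace ℝ κ} (hx : x ≠ 0) :
    _root_.dirDeriv w (_root_.flatLap f) x = _root_.flatLap (_root_.dirDeriv w f) x := by
  have : _root_.dirDeriv w (_root_.flatLap f) x = ∑ i, _root_.dirDeriv w
      (_root_.dirDeriv (EuclideanSpace.single i 1)
        (_root_.dirDeriv (EuclideanSpace.single i 1) f)) x := by
    rw [_root_.dirDeriv]
    unfold _root_.flatLap
    rw [fderiv_fun_sum fun i _ => ((hf.dirDeriv _).dirDeriv _).differentiableAt hx]
    simp [_root_.dirDeriv]
  rw [this]
  refine Finset.sum_congr rfl fun i _ => ?_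
  rw [(hf.dirDeriv _).dirDeriv_comm w _ hx]
  exact dirDeriv_congr (fun y hy => hf.dirDeriv_comm w _ hy) _ hx

end SmoothOffZero

namespace HomogOffZero

variable {f : EuclideanSpace ℝ κ → ℝ} {k : ℤ}

theorem dirDeriv (hf : HomogOffZero k f) (w : EuclideanSpace ℝ κ) :
    HomogOffZero (k - 1) (dirDeriv w f) := by
  intro c hc x hx
  have h : (fun y => f (c • y)) =ᶠ[nhds x] c ^ k • f :=
    (eventually_ne_zero hx).mono fun y hy => hf c hc y hy
  have h1 := h.fderiv_eq (𝕜 := ℝ)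
  rw [fderiv_comp_smul, fderiv_const_smul_field (c ^ k)] at h1
  have h2 : c * _root_.dirDeriv w f (c • x) = c ^ k * _root_.dirDeriv w f x := by
    simpa [_root_.dirDeriv] using congrArg (fun L => L w) h1
  rw [zpow_sub_one₀ hc.ne']
  field_simp
  linarith

theorem flatLap [DecidableEq κ] (hf : HomogOffZero k f) : HomogOffZero (k - 1 - 1) (flatLap f) := by
  intro c hc x hx
  rw [_root_.flatLap, _root_.flatLap, Finset.mul_sum]
  exact Finset.sum_congr rfl fun i _ => (hf.dirDeriv _).dirDeriv _ c hc x hx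

/-- Euler's identity. -/
theorem dirDeriv_self (hf : HomogOffZero k f) {x : EuclideanSpace ℝ κ} (hx : x ≠ 0)
    (hd : DifferentiableAt ℝ f x) : _root_.dirDeriv x f x = k * f x := by
  have h1 : HasDerivAt (fun c : ℝ => f (c • x)) (fderiv ℝ f x x) 1 := by
    have hl : HasDerivAt (fun c : ℝ => c • x) x 1 := by
      simpa using (hasDerivAt_id (1 : ℝ)).smul_const x
    have hd' : HasFDerivAt f (fderiv ℝ f x) ((1 : ℝ) • x) := by
      simpa using hd.hasFDerivAt
    exact hd'.comp_hasDerivAt (1 : ℝ) hl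
  have h2 : HasDerivAt (fun c : ℝ => c ^ k * f x) (k * f x) 1 := by
    simpa using (hasDerivAt_zpow k (1 : ℝ) (Or.inl one_ne_zero)).mul_const (f x)
  refine h1.unique (h2.congr_of_eventuallyEq ?_)
  filter_upwards [lt_mem_nhds (zero_lt_one' ℝ)] with c hc using hf c hc x hx

end HomogOffZero

/-- On the sphere, the spherical Laplacian of a `0`-homogeneous function is its flat Laplacian. -/
theorem lapS_eq_flatLap [DecidableEq κ] {f : EuclideanSpace ℝ κ → ℝ} (hf : SmoothOffZero f)
    (hh : HomogOffZero 0 f) {x : EuclideanSpace ℝ κ} (hx : x ≠ 0) :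
    lapS f x = flatLap f x := by
  have hgrad : gradS f =ᶠ[nhds x] gradient f := by
    filter_upwards [eventually_ne_zero hx] with y hy
    have h0 := hh.dirDeriv_self hy (hf.differentiableAt hy)
    rw [gradS, inner_gradient_left, show fderiv ℝ f y y = 0 by simpa [dirDeriv] using h0]
    simp
  have hd : DifferentiableAt ℝ (gradient f) x := by
    rw [differentiableAt_euclidean]
    intro i
    have : (fun y => gradient f y i) = dirDeriv (EuclideanSpace.single i 1) f := by
      ext y
      rw [dirDeriv, ← inner_gradient_left, EuclideanSpace.inner_single_right]
      simp
    rw [this]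
    exact (hf.dirDeriv _).differentiableAt hx
  have key : ∀ v w, ⟪fderiv ℝ (gradient f) x v, w⟫ = dirDeriv v (dirDeriv w f) x := by
    intro v w
    have : dirDeriv w f = fun y => ⟪gradient f y, w⟫ := by
      ext y
      rw [dirDeriv, inner_gradient_left]
    rw [this, dirDeriv, fderiv_inner_apply ℝ hd (differentiableAt_const w)]
    simp
  rw [lapS, divS, hgrad.fderiv_eq]
  simp only [key]
  rw [(hh.dirDeriv x).dirDeriv_self hx ((hf.dirDeriv x).differentiableAt hx),
    hh.dirDeriv_self hx (hf.differentiableAt hx)]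
  simp [flatLap]

/-- In dimension three, multiplying a `(-1)`-homogeneous function by `‖x‖` does not change its
flat Laplacian along the unit sphere. -/
theorem flatLap_norm_mul {g : EuclideanSpace ℝ (Fin 3) → ℝ} (hg : SmoothOffZero g)
    (hh : HomogOffZero (-1) g) {x : EuclideanSpace ℝ (Fin 3)} (hx : ‖x‖ = 1) :
    flatLap (fun y => ‖y‖ * g y) x = flatLap g x := by
  have hx0 : x ≠ 0 := norm_ne_zero_iff.1 (by simp [hx])
  have hn := SmoothOffZero.norm (κ := Fin 3)
  have hn' := SmoothOffZero.inv_norm (κ := Fin 3)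
  have key : ∀ w : EuclideanSpace ℝ (Fin 3),
      dirDeriv w (dirDeriv w fun y => ‖y‖ * g y) x = (⟪w, w⟫ - ⟪x, w⟫ ^ 2) * g x
        + 2 * (⟪x, w⟫ * dirDeriv w g x) + dirDeriv w (dirDeriv w g) x := by
    intro w
    have hi : SmoothOffZero fun y : EuclideanSpace ℝ (Fin 3) => ⟪y, w⟫ :=
      fun y _ => contDiffAt_id.inner ℝ contDiffAt_const
    rw [dirDeriv_congr (g := fun y => ‖y‖ * dirDeriv w g y + ⟪y, w⟫ * (‖y‖⁻¹ * g y))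
      (fun y hy => by
        rw [dirDeriv_mul (hn.differentiableAt hy) (hg.differentiableAt hy), dirDeriv_norm w hy]
        ring) w hx0,
      dirDeriv_add ((hn.mul (hg.dirDeriv w)).differentiableAt hx0)
        ((hi.mul (hn'.mul hg)).differentiableAt hx0),
      dirDeriv_mul (hn.differentiableAt hx0) ((hg.dirDeriv w).differentiableAt hx0),
      dirDeriv_mul (hi.differentiableAt hx0) ((hn'.mul hg).differentiableAt hx0),
      dirDeriv_mul (hn'.differentiableAt hx0) (hg.differentiableAt hx0),
      dirDeriv_norm w hx0, dirDeriv_inv_norm w hx0, dirDeriv_inner, hx]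
    ring
  have he := hh.dirDeriv_self hx0 (hg.differentiableAt hx0)
  have hs : ∑ i, x i ^ 2 = 1 := by
    rw [← EuclideanSpace.real_norm_sq_eq, hx, one_pow]
  rw [dirDeriv_sum_single] at he
  simp only [Fin.sum_univ_three] at he hs
  simp only [flatLap, key, EuclideanSpace.inner_single_right, Fin.sum_univ_three]
  simp
  push_cast at he
  linear_combination 2 * he - g x * hs

end SphericalCalculus

/-- If `(a, b)` solves `ε² Δa = (a² + b² - 1) a` with its `0`-homogeneous extension, and the
derivatives of `a` satisfy the linearized equation on the sphere, then `Δa = 0` there. -/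
theorem flatLap_eq_zero_of_linearized {ε : ℝ} (hε : 0 < ε)
    {a b : EuclideanSpace ℝ (Fin 3) → ℝ} (ha : SmoothOffZero a) (hb : SmoothOffZero b)
    (hsol : ∀ y, y ≠ 0 → ε ^ 2 * (‖y‖ ^ 2 * flatLap a y) = (a y * a y + b y * b y + -1) * a y)
    {x : EuclideanSpace ℝ (Fin 3)} (hx : ‖x‖ = 1)
    (hker : ∀ i, ε ^ 2 * flatLap (dirDeriv (EuclideanSpace.single i 1) a) x =
      (a x ^ 2 + b x ^ 2 - 1) * dirDeriv (EuclideanSpace.single i 1) a x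
        + 2 * (a x * dirDeriv (EuclideanSpace.single i 1) a x
          + b x * dirDeriv (EuclideanSpace.single i 1) b x) * a x) :
    flatLap a x = 0 := by
  have hx0 : x ≠ 0 := norm_ne_zero_iff.1 (by simp [hx])
  have hc : ∀ c : ℝ, SmoothOffZero fun _ : EuclideanSpace ℝ (Fin 3) => c :=
    fun c _ _ => contDiffAt_const
  have dc : ∀ (c : ℝ) (w : EuclideanSpace ℝ (Fin 3)), dirDeriv w (fun _ => c) x = 0 := by
    intro c w
    simp [dirDeriv]
  have hn : SmoothOffZero fun y : EuclideanSpace ℝ (Fin 3) => ‖y‖ ^ 2 :=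
    fun y hy => (contDiffAt_norm ℝ hy).pow 2
  have hg := (ha.mul ha).add (hb.mul hb)
  have key : ∀ i, x i * flatLap a x = 0 := by
    intro i
    have h := dirDeriv_congr hsol (EuclideanSpace.single i 1) hx0
    rw [dirDeriv_mul ((hc _).differentiableAt hx0) ((hn.mul ha.flatLap).differentiableAt hx0),
      dirDeriv_mul (hn.differentiableAt hx0) (ha.flatLap.differentiableAt hx0),
      dirDeriv_mul ((hg.add (hc (-1))).differentiableAt hx0) (ha.differentiableAt hx0),
      dirDeriv_add (hg.differentiableAt hx0) ((hc _).differentiableAt hx0),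
      dirDeriv_add ((ha.mul ha).differentiableAt hx0) ((hb.mul hb).differentiableAt hx0),
      dirDeriv_mul (ha.differentiableAt hx0) (ha.differentiableAt hx0),
      dirDeriv_mul (hb.differentiableAt hx0) (hb.differentiableAt hx0),
      dc, dc, dirDeriv_norm_sq, hx, ha.dirDeriv_flatLap _ hx0,
      EuclideanSpace.inner_single_right] at h
    simp only [conj_trivial] at h
    have h' : ε ^ 2 * (x i * flatLap a x) = 0 := by
      linear_combination (1 / 2) * h - (1 / 2) * hker i
    exact (mul_eq_zero.1 h').resolve_left (by positivity)
  obtain ⟨i, hi⟩ : ∃ i, x i ≠ 0 := by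
    by_contra! h
    exact hx0 (by ext i; simp [h i])
  exact (mul_eq_zero.1 (key i)).resolve_left hi

/-- A pair of functions, harmonic off the origin and satisfying `(a² + b² - 1)(a, b) = 0`,
has vanishing derivatives. -/
theorem dirDeriv_eq_zero_of_harmonic {κ : Type*} [Fintype κ] [DecidableEq κ]
    {a b : EuclideanSpace ℝ κ → ℝ} (ha : SmoothOffZero a) (hb : SmoothOffZero b)
    (hLa : ∀ y, y ≠ 0 → flatLap a y = 0) (hLb : ∀ y, y ≠ 0 → flatLap b y = 0)
    (hga : ∀ y, y ≠ 0 → (a y ^ 2 + b y ^ 2 - 1) * a y = 0)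
    (hgb : ∀ y, y ≠ 0 → (a y ^ 2 + b y ^ 2 - 1) * b y = 0)
    {x : EuclideanSpace ℝ κ} (hx : x ≠ 0) (i : κ) :
    dirDeriv (EuclideanSpace.single i 1) a x = 0 ∧
      dirDeriv (EuclideanSpace.single i 1) b x = 0 := by
  have hg := (ha.mul ha).add (hb.mul hb)
  have hD : ∀ w y, y ≠ 0 → a y * dirDeriv w a y + b y * dirDeriv w b y = 0 := by
    intro w y hy
    have hgg : ∀ z, z ≠ 0 → (a z * a z + b z * b z) * (a z * a z + b z * b z)
        = a z * a z + b z * b z := fun z hz => by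
      linear_combination a z * hga z hz + b z * hgb z hz
    have h := dirDeriv_congr hgg w hy
    rw [dirDeriv_mul (hg.differentiableAt hy) (hg.differentiableAt hy),
      dirDeriv_add ((ha.mul ha).differentiableAt hy) ((hb.mul hb).differentiableAt hy),
      dirDeriv_mul (ha.differentiableAt hy) (ha.differentiableAt hy),
      dirDeriv_mul (hb.differentiableAt hy) (hb.differentiableAt hy)] at h
    have h1 : (2 * (a y * a y + b y * b y) - 1) *
        (a y * dirDeriv w a y + b y * dirDeriv w b y) = 0 := by
      linear_combination (1 / 2) * h
    have h2 : 2 * (a y * a y + b y * b y) - 1 ≠ 0 := by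
      intro h0
      have := hgg y hy
      nlinarith
    exact (mul_eq_zero.1 h1).resolve_left h2
  have hDD : ∀ w : EuclideanSpace ℝ κ, dirDeriv w a x ^ 2 + dirDeriv w b x ^ 2
      + (a x * dirDeriv w (dirDeriv w a) x + b x * dirDeriv w (dirDeriv w b) x) = 0 := by
    intro w
    have h := dirDeriv_congr (g := fun _ => 0) (hD w) w hx
    rw [dirDeriv_add ((ha.mul (ha.dirDeriv w)).differentiableAt hx)
        ((hb.mul (hb.dirDeriv w)).differentiableAt hx),
      dirDeriv_mul (ha.differentiableAt hx) ((ha.dirDeriv w).differentiableAt hx),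
      dirDeriv_mul (hb.differentiableAt hx) ((hb.dirDeriv w).differentiableAt hx)] at h
    have h0 : dirDeriv w (fun _ => (0 : ℝ)) x = 0 := by simp [dirDeriv]
    linear_combination h + h0
  have hsum : ∑ j, (dirDeriv (EuclideanSpace.single j 1) a x ^ 2
      + dirDeriv (EuclideanSpace.single j 1) b x ^ 2) = 0 := by
    have h : ∑ j : κ, _ = ∑ j : κ, (0 : ℝ) :=
      Finset.sum_congr rfl fun j _ => hDD (EuclideanSpace.single j 1)
    rw [Finset.sum_add_distrib, Finset.sum_add_distrib (g := fun j => b x * _),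
      ← Finset.mul_sum, ← Finset.mul_sum] at h
    have hLax := hLa x hx
    have hLbx := hLb x hx
    rw [flatLap] at hLax hLbx
    rw [hLax, hLbx] at h
    simpa using h
  have := (Finset.sum_eq_zero_iff_of_nonneg fun j _ => by positivity).1 hsum i (Finset.mem_univ i)
  constructor <;> nlinarith [sq_nonneg (dirDeriv (EuclideanSpace.single i 1) a x),
    sq_nonneg (dirDeriv (EuclideanSpace.single i 1) b x)]

theorem lapSC_re (u : EuclideanSpace ℝ ι → ℂ) (x : EuclideanSpace ℝ ι) :
    (lapSC u x).re = lapS (uRe u) x := by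
  simp [lapSC]

theorem lapSC_im (u : EuclideanSpace ℝ ι → ℂ) (x : EuclideanSpace ℝ ι) :
    (lapSC u x).im = lapS (uIm u) x := by
  simp [lapSC]

theorem sq_norm_eq_uRe_uIm {κ : Type*} (u : EuclideanSpace ℝ κ → ℂ) (x : EuclideanSpace ℝ κ) :
    ‖u x‖ ^ 2 = uRe u x ^ 2 + uIm u x ^ 2 := by
  rw [Complex.sq_norm, Complex.normSq_apply, uRe, uIm]
  ring

/-- The equation `ε² Δa = h a` on the sphere, extended by homogeneity. -/
theorem flatLap_eq_of_lapS_eq {ε : ℝ} {a h : EuclideanSpace ℝ ι → ℝ} (ha : SmoothOffZero a)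
    (hha : HomogOffZero 0 a) (hh : HomogOffZero 0 h)
    (hsol : ∀ x ∈ Sph ι, ε ^ 2 * lapS a x = h x * a x) {y : EuclideanSpace ℝ ι} (hy : y ≠ 0) :
    ε ^ 2 * (‖y‖ ^ 2 * flatLap a y) = h y * a y := by
  have hn : 0 < ‖y‖ := norm_pos_iff.2 hy
  have hz : ‖y‖⁻¹ • y ∈ Sph ι := by
    simp [Sph, norm_smul, hn.ne']
  have h1 := hsol _ hz
  rw [lapS_eq_flatLap ha hha (by simp [hy]), hha.flatLap _ (inv_pos.2 hn) y hy,
    hha _ (inv_pos.2 hn) y hy, hh _ (inv_pos.2 hn) y hy] at h1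
  rw [show (0 : ℤ) - 1 - 1 = -2 by norm_num, inv_zpow, zpow_neg, inv_inv] at h1
  simpa using h1

/-- Let `u : S² → ℂ` be a smooth stable solution of
`ε²Δu = (|u|²-1)u` on the round 2-sphere (realized as the unit sphere of `ℝ³`, with
functions given by 0-homogeneous ambient extensions).  For `i = 1, 2, 3` let
`v_i = ⟨∇u, X_{ξ_i}⟩`; on the sphere `v_i(x) = ∂u/∂ξ_i(x)`, and
`v_i(x) = ‖x‖ • (fderiv u x ξ_i)` is its 0-homogeneous extension.  If each `v_i` lies in
the kernel of the linearized operator,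
`Δv_i = ((|u|²-1)/ε²)v_i + (2/ε²)(u·v_i)u`, then `Δu ≡ 0` on `S²` and `u` is constant. -/
theorem stmt13 (ε : ℝ) (hε : 0 < ε)
    (u : EuclideanSpace ℝ (Fin 3) → ℂ)
    (hsol : IsGLSolution ε u) (hstab : IsStable (2 : ℝ) ε u)
    (v : Fin 3 → EuclideanSpace ℝ (Fin 3) → ℂ)
    (hv : ∀ i, v i = fun x => (‖x‖ : ℝ) • fderiv ℝ u x (EuclideanSpace.single i (1 : ℝ)))
    (hker : ∀ i, ∀ x ∈ Sph (Fin 3),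
      lapSC (v i) x = (((‖u x‖ ^ 2 - 1) / ε ^ 2 : ℝ) : ℂ) * v i x
        + ((2 / ε ^ 2 * cdot (u x) (v i x) : ℝ) : ℂ) * u x) :
    (∀ x ∈ Sph (Fin 3), lapSC u x = 0) ∧ ∃ c : ℂ, ∀ x ∈ Sph (Fin 3), u x = c := by
  obtain ⟨⟨hsm, hhom⟩, hsol⟩ := hsol
  have hcd : ∀ x, x ≠ 0 → ContDiffAt ℝ (⊤ : ℕ∞) u x := fun x hx =>
    (hsm x hx).contDiffAt (isOpen_ne.mem_nhds hx)
  have hud : ∀ x, x ≠ 0 → DifferentiableAt ℝ u x := fun x hx =>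
    (hcd x hx).differentiableAt (by simp)
  have ha : SmoothOffZero (uRe u) := fun x hx =>
    Complex.reCLM.contDiff.contDiffAt.comp x (hcd x hx)
  have hb : SmoothOffZero (uIm u) := fun x hx =>
    Complex.imCLM.contDiff.contDiffAt.comp x (hcd x hx)
  have hha : HomogOffZero 0 (uRe u) := fun c hc x hx => by simp [uRe, hhom c hc x hx]
  have hhb : HomogOffZero 0 (uIm u) := fun c hc x hx => by simp [uIm, hhom c hc x hx]
  have hda : ∀ x, x ≠ 0 → ∀ w, (fderiv ℝ u x w).re = dirDeriv w (uRe u) x := fun x hx w => by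
    have := (Complex.reCLM.hasFDerivAt.comp x (hud x hx).hasFDerivAt).fderiv
    exact (congrArg (fun L => L w) this).symm
  have hdb : ∀ x, x ≠ 0 → ∀ w, (fderiv ℝ u x w).im = dirDeriv w (uIm u) x := fun x hx w => by
    have := (Complex.imCLM.hasFDerivAt.comp x (hud x hx).hasFDerivAt).fderiv
    exact (congrArg (fun L => L w) this).symm
  have hne : ∀ x ∈ Sph (Fin 3), x ≠ 0 := fun x hx =>
    norm_ne_zero_iff.1 (by rw [show ‖x‖ = 1 from hx]; exact one_ne_zero)
  have hε2 : ε ^ 2 ≠ 0 := by positivity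
  have hh : HomogOffZero 0 fun y => ‖u y‖ ^ 2 - 1 := fun c hc x hx => by simp [hhom c hc x hx]
  have hsola : ∀ y, y ≠ 0 → ε ^ 2 * (‖y‖ ^ 2 * flatLap (uRe u) y) = (‖u y‖ ^ 2 - 1) * uRe u y :=
    fun y hy => flatLap_eq_of_lapS_eq ha hha hh (fun x hx => by
      have := congrArg Complex.re (hsol x hx)
      rwa [← Complex.ofReal_pow, Complex.re_ofReal_mul, Complex.re_ofReal_mul, lapSC_re] at this) hy
  have hsolb : ∀ y, y ≠ 0 → ε ^ 2 * (‖y‖ ^ 2 * flatLap (uIm u) y) = (‖u y‖ ^ 2 - 1) * uIm u y :=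
    fun y hy => flatLap_eq_of_lapS_eq hb hhb hh (fun x hx => by
      have := congrArg Complex.im (hsol x hx)
      rwa [← Complex.ofReal_pow, Complex.im_ofReal_mul, Complex.im_ofReal_mul, lapSC_im] at this) hy
  -- the spherical Laplacian of `‖x‖ ∂f/∂w` is the flat Laplacian of `∂f/∂w`
  have hlap : ∀ {f g : EuclideanSpace ℝ (Fin 3) → ℝ} {w x}, SmoothOffZero f → HomogOffZero 0 f →
      (∀ y, y ≠ 0 → g y = ‖y‖ * dirDeriv w f y) → x ∈ Sph (Fin 3) →
      lapS g x = flatLap (dirDeriv w f) x := by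
    intro f g w x hf hhf hg hx
    have hgs : SmoothOffZero g := fun y hy =>
      ((SmoothOffZero.norm.mul (hf.dirDeriv w)) y hy).congr_of_eventuallyEq
        ((eventually_ne_zero hy).mono hg)
    have hgh : HomogOffZero 0 g := fun c hc y hy => by
      rw [hg _ (smul_ne_zero hc.ne' hy), hg y hy, hhf.dirDeriv w c hc y hy, norm_smul,
        Real.norm_of_nonneg hc.le]
      simp only [zero_sub, zpow_neg_one, zpow_zero]
      field_simp
    rw [lapS_eq_flatLap hgs hgh (hne x hx), ← flatLap_norm_mul (hf.dirDeriv w)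
      (by simpa using hhf.dirDeriv w) hx]
    refine Finset.sum_congr rfl fun i _ => ?_
    exact dirDeriv_congr (fun y hy => dirDeriv_congr hg _ hy) _ (hne x hx)
  have hva : ∀ i y, y ≠ 0 → uRe (v i) y = ‖y‖ * dirDeriv (EuclideanSpace.single i 1) (uRe u) y :=
    fun i y hy => by simp [uRe, hv i, ← hda y hy]
  have hvb : ∀ i y, y ≠ 0 → uIm (v i) y = ‖y‖ * dirDeriv (EuclideanSpace.single i 1) (uIm u) y :=
    fun i y hy => by simp [uIm, hv i, ← hdb y hy]
  have hLa : ∀ x ∈ Sph (Fin 3), flatLap (uRe u) x = 0 := fun x hx => by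
    refine flatLap_eq_zero_of_linearized hε ha hb (fun y hy => ?_) hx fun i => ?_
    · rw [hsola y hy, sq_norm_eq_uRe_uIm]
      ring
    · have h := congrArg Complex.re (hker i x hx)
      rw [lapSC_re, Complex.add_re, Complex.re_ofReal_mul, Complex.re_ofReal_mul,
        hlap ha hha (hva i) hx, sq_norm_eq_uRe_uIm] at h
      have h1 := hva i x (hne x hx)
      have h2 := hvb i x (hne x hx)
      rw [show ‖x‖ = 1 from hx, one_mul] at h1 h2
      rw [← h1, ← h2, h]
      simp only [uRe, uIm, cdot]
      field_simp
  have hLb : ∀ x ∈ Sph (Fin 3), flatLap (uIm u) x = 0 := fun x hx => by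
    refine flatLap_eq_zero_of_linearized hε hb ha (fun y hy => ?_) hx fun i => ?_
    · rw [hsolb y hy, sq_norm_eq_uRe_uIm]
      ring
    · have h := congrArg Complex.im (hker i x hx)
      rw [lapSC_im, Complex.add_im, Complex.im_ofReal_mul, Complex.im_ofReal_mul,
        hlap hb hhb (hvb i) hx, sq_norm_eq_uRe_uIm] at h
      have h1 := hva i x (hne x hx)
      have h2 := hvb i x (hne x hx)
      rw [show ‖x‖ = 1 from hx, one_mul] at h1 h2
      rw [← h1, ← h2, h]
      simp only [uRe, uIm, cdot]
      field_simp
      ring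
  have hext : ∀ {f : EuclideanSpace ℝ (Fin 3) → ℝ}, HomogOffZero 0 f →
      (∀ x ∈ Sph (Fin 3), flatLap f x = 0) → ∀ y, y ≠ 0 → flatLap f y = 0 := by
    intro f hf h0 y hy
    have hn : 0 < ‖y‖ := norm_pos_iff.2 hy
    have h1 := hf.flatLap _ (inv_pos.2 hn) y hy
    rw [h0 _ (by simp [Sph, norm_smul, hn.ne'])] at h1
    exact (mul_eq_zero.1 h1.symm).resolve_left (zpow_ne_zero _ (inv_pos.2 hn).ne')
  have hLa' := hext hha hLa
  have hLb' := hext hhb hLb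
  refine ⟨fun x hx => ?_, ?_⟩
  · rw [lapSC, lapS_eq_flatLap ha hha (hne x hx), lapS_eq_flatLap hb hhb (hne x hx),
      hLa x hx, hLb x hx]
    simp
  · have hzero : ∀ x, x ≠ 0 → fderiv ℝ u x = 0 := by
      intro x hx
      have hD := dirDeriv_eq_zero_of_harmonic ha hb hLa' hLb'
        (fun y hy => by rw [← sq_norm_eq_uRe_uIm, ← hsola y hy, hLa' y hy]; simp)
        (fun y hy => by rw [← sq_norm_eq_uRe_uIm, ← hsolb y hy, hLb' y hy]; simp) hx
      ext w
      apply Complex.ext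
      · rw [hda x hx, dirDeriv_sum_single]
        simp [hD]
      · rw [hdb x hx, dirDeriv_sum_single]
        simp [hD]
    have hconn : IsPreconnected ({0}ᶜ : Set (EuclideanSpace ℝ (Fin 3))) :=
      (isConnected_compl_singleton_of_one_lt_rank (Module.one_lt_rank_of_one_lt_finrank (by simp))
        0).isPreconnected
    obtain ⟨c, hc⟩ := isOpen_compl_singleton.exists_is_const_of_fderiv_eq_zero (𝕜 := ℝ) hconn
      (fun x hx => (hud x hx).differentiableWithinAt) (fun x hx => hzero x hx)
    exact ⟨c, fun x hx => hc x (hne x hx)⟩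

end
end
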